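/- Let Ω be a germ at a point x₀ of a differential 2-form of rank 4 on a 4-dimensional manifold which is of type 2. Then there exist a local coordinate system (x¹,x²,x³,x⁴) centred at x₀ and a smooth function u = u(x¹,x²,x³) vanishing at the origin such that ((∂u/∂x¹)² + (∂u/∂x²)²)(0,0,0) > 0 and Ω = exp((1+u)x³) dx¹∧dx² + dx³∧dx⁴. -/

import Mathlib

/-!  Coordinate formalization of differential forms in four variables,
     following "The equivalence problem of differential 2-forms in 4 variables". -/

open Real Filter

/-- Points of `ℝ⁴`; the coordinates `x¹, x², x³, x⁴` of the paper are `x 0, x 1, x 2, x 3`. -/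
abbrev Pt := Fin 4 → ℝ

/-- Partial derivative `∂f/∂xⁱ`. -/
noncomputable def pd (i : Fin 4) (f : Pt → ℝ) (x : Pt) : ℝ :=
  fderiv ℝ f x (Pi.single i 1)

/-- Second partial derivative `∂²f/∂xⁱ∂xʲ`. -/
noncomputable def pd2 (i j : Fin 4) (f : Pt → ℝ) (x : Pt) : ℝ :=
  pd i (fun y => pd j f y) x

/-- Differential forms of degree 0,1,2,3,4 on `ℝ⁴`, given by their (skew-symmetric)
    coordinate components, and vector fields. -/
abbrev Form0 := Pt → ℝ
abbrev Form1 := Pt → Fin 4 → ℝ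
abbrev Form2 := Pt → Fin 4 → Fin 4 → ℝ
abbrev Form3 := Pt → Fin 4 → Fin 4 → Fin 4 → ℝ
abbrev Form4 := Pt → Fin 4 → Fin 4 → Fin 4 → Fin 4 → ℝ
abbrev Vec := Pt → Fin 4 → ℝ

/-- A 2-form has skew-symmetric components. -/
def Alt2 (B : Form2) : Prop := ∀ x i j, B x i j = - B x j i

/-- Exterior derivative of a function. -/
noncomputable def d0 (f : Form0) : Form1 := fun x i => pd i f x

/-- Exterior derivative of a 1-form. -/
noncomputable def d1 (ω : Form1) : Form2 := fun x i j =>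
  pd i (fun y => ω y j) x - pd j (fun y => ω y i) x

/-- Exterior derivative of a 2-form. -/
noncomputable def d2 (B : Form2) : Form3 := fun x i j k =>
  pd i (fun y => B y j k) x - pd j (fun y => B y i k) x + pd k (fun y => B y i j) x

/-- Wedge product of two 1-forms. -/
def w11 (ω η : Form1) : Form2 := fun x i j => ω x i * η x j - ω x j * η x i

/-- Wedge product of a 1-form and a 2-form. -/
def w12 (ω : Form1) (B : Form2) : Form3 := fun x i j k =>
  ω x i * B x j k - ω x j * B x i k + ω x k * B x i j

/-- Wedge product of a 1-form and a 3-form. -/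
def w13 (ω : Form1) (C : Form3) : Form4 := fun x i j k l =>
  ω x i * C x j k l - ω x j * C x i k l + ω x k * C x i j l - ω x l * C x i j k

/-- Wedge product of two 2-forms. -/
def w22 (A B : Form2) : Form4 := fun x i j k l =>
  A x i j * B x k l - A x i k * B x j l + A x i l * B x j k
    + A x j k * B x i l - A x j l * B x i k + A x k l * B x i j

/-- A 2-form is of rank 4 when `Ω ∧ Ω` vanishes nowhere. -/
def Rank4 (B : Form2) : Prop := ∀ x, w22 B B x ≠ 0

/-- Interior products `i_X`. -/
def i1 (X : Vec) (ω : Form1) : Form0 := fun x => ∑ i, X x i * ω x i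
def i2 (X : Vec) (B : Form2) : Form1 := fun x j => ∑ i, X x i * B x i j
def i3 (X : Vec) (C : Form3) : Form2 := fun x j k => ∑ i, X x i * C x i j k
def i4 (X : Vec) (D : Form4) : Form3 := fun x j k l => ∑ i, X x i * D x i j k l

/-- Evaluation `B(X,Y)` of a 2-form on two vector fields. -/
def ev2 (B : Form2) (X Y : Vec) : Form0 := fun x => ∑ i, ∑ j, X x i * Y x j * B x i j

/-- Evaluation `D(X,Y,Z,W)` of a 4-form on four vector fields. -/
def ev4 (D : Form4) (X Y Z W : Vec) : Form0 := fun x =>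
  ∑ i, ∑ j, ∑ k, ∑ l, X x i * Y x j * Z x k * W x l * D x i j k l

/-- Lie derivative of a 1-form (Cartan's magic formula). -/
noncomputable def lie1 (X : Vec) (ω : Form1) : Form1 := fun x i =>
  d0 (i1 X ω) x i + i2 X (d1 ω) x i

/-- Lie derivative of a 2-form (Cartan's magic formula). -/
noncomputable def lie2 (X : Vec) (B : Form2) : Form2 := fun x i j =>
  d1 (i2 X B) x i j + i3 X (d2 B) x i j

/-- Lie bracket of two vector fields. -/
noncomputable def bracket (X Y : Vec) : Vec := fun x i =>
  ∑ j, (X x j * pd j (fun y => Y y i) x - Y x j * pd j (fun y => X y i) x)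

/-- Derivative `X(f)` of a function along a vector field. -/
noncomputable def dirDeriv (X : Vec) (f : Form0) : Form0 := fun x => ∑ j, X x j * pd j f x

/-- Pullback of a 1-form under a smooth map. -/
noncomputable def pull1 (φ : Pt → Pt) (ω : Form1) : Form1 := fun x i =>
  ∑ a, ω (φ x) a * pd i (fun y => φ y a) x

/-- Pullback of a 2-form under a smooth map. -/
noncomputable def pull2 (φ : Pt → Pt) (B : Form2) : Form2 := fun x i j =>
  ∑ a, ∑ b, B (φ x) a b * pd i (fun y => φ y a) x * pd j (fun y => φ y b) x

/-- A pair of mutually inverse smooth maps: a diffeomorphism of `ℝ⁴` (with inverse). -/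
def IsDiffeo (φ ψ : Pt → Pt) : Prop :=
  ContDiff ℝ (⊤ : ℕ∞) φ ∧ ContDiff ℝ (⊤ : ℕ∞) ψ ∧ (∀ x, ψ (φ x) = x) ∧ (∀ x, φ (ψ x) = x)

/-- The covector with components `c` as a linear functional on the tangent space `ℝ⁴`. -/
noncomputable def covec (c : Fin 4 → ℝ) : Pt →ₗ[ℝ] ℝ :=
  ∑ i, c i • (LinearMap.proj i : Pt →ₗ[ℝ] ℝ)

/-- The class of a 1-form `ω` at `x`: the codimension of the space of tangent vectors `v`
    with `i_v ω = 0` and `i_v (dω) = 0`. -/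
noncomputable def classAt (ω : Form1) (x : Pt) : ℕ :=
  4 - Module.finrank ℝ
    ↥(LinearMap.ker (covec (ω x)) ⊓ ⨅ j, LinearMap.ker (covec (fun i => d1 ω x i j)))

/-- Components of the constant 2-form `dxᵃ ∧ dxᵇ`. -/
def dxw (a b : Fin 4) : Fin 4 → Fin 4 → ℝ := fun i j =>
  (if i = a ∧ j = b then (1:ℝ) else 0) - (if i = b ∧ j = a then (1:ℝ) else 0)

/-- A germ of 2-form (with associated 1-form `ω = ω_Ω`) is of type `t` at `x₀`:
    `ω` is nonsingular at `x₀` and of constant class `t` near `x₀`. -/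
def IsTypeAt (ω : Form1) (t : ℕ) (x₀ : Pt) : Prop :=
  ω x₀ ≠ 0 ∧ ∀ᶠ x in nhds x₀, classAt ω x = t

section Nemytskii
open Topology

variable {K : Type} [TopologicalSpace K] [CompactSpace K]

/-- the multiplication operator associated with a continuous family of operators -/
noncomputable def famOp (K : Type) [TopologicalSpace K] [CompactSpace K]
    (E F : Type) [NormedAddCommGroup E] [NormedSpace ℝ E] [NormedAddCommGroup F] [NormedSpace ℝ F] :
    C(K, E →L[ℝ] F) →L[ℝ] (C(K, E) →L[ℝ] C(K, F)) :=
  LinearMap.mkContinuous₂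
    (LinearMap.mk₂ ℝ (fun (A : C(K, E →L[ℝ] F)) (h : C(K, E)) =>
        (⟨fun s => A s (h s), by fun_prop⟩ : C(K, F)))
      (by intros; ext; simp) (by intros; ext; simp) (by intros; ext; simp) (by intros; ext; simp))
    1 (by
      intro A h
      rw [ContinuousMap.norm_le _ (by positivity)]
      intro s
      simp only [LinearMap.mk₂_apply, ContinuousMap.coe_mk, one_mul]
      exact (A s).le_of_opNorm_le_of_le (A.norm_coe_le_norm s) (h.norm_coe_le_norm s))

lemma famOp_apply {E F : Type} [NormedAddCommGroup E] [NormedSpace ℝ E] [NormedAddCommGroup F]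
    [NormedSpace ℝ F] (A : C(K, E →L[ℝ] F)) (h : C(K, E)) (s : K) :
    famOp K E F A h s = A s (h s) := rfl

/-- the Nemytskii (superposition) operator -/
def nem {E F : Type} [TopologicalSpace E] [TopologicalSpace F] (f : C(E, F)) (γ : C(K, E)) :
    C(K, F) := f.comp γ

lemma nem_hasFDerivAt {E F : Type} [NormedAddCommGroup E] [NormedSpace ℝ E]
    [NormedAddCommGroup F] [NormedSpace ℝ F] (f : C(E, F)) (hf : Differentiable ℝ f)
    (hf' : Continuous (fderiv ℝ f)) (γ : C(K, E)) :
    HasFDerivAt (nem f : C(K, E) → C(K, F))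
      (famOp K E F (nem ⟨fderiv ℝ f, hf'⟩ γ)) γ := by
  rw [hasFDerivAt_iff_isLittleO_nhds_zero, Asymptotics.isLittleO_iff]
  intro c hc
  have hcont : Continuous (nem ⟨fderiv ℝ f, hf'⟩ : C(K, E) → C(K, E →L[ℝ] F)) :=
    ContinuousMap.continuous_postcomp _
  obtain ⟨δ, hδ, hball⟩ := (Metric.continuousAt_iff
    (f := (nem ⟨fderiv ℝ f, hf'⟩ : C(K, E) → C(K, E →L[ℝ] F))) (a := γ)).1
    hcont.continuousAt c hc
  filter_upwards [Metric.ball_mem_nhds (0 : C(K, E)) hδ] with h hh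
  rw [mem_ball_zero_iff] at hh
  rw [ContinuousMap.norm_le _ (by positivity)]
  intro s
  have key : ‖f (γ s + h s) - f (γ s) - (fderiv ℝ f (γ s)) (γ s + h s - γ s)‖
      ≤ c * ‖γ s + h s - γ s‖ := by
    refine (convex_ball (γ s) δ).norm_image_sub_le_of_norm_fderiv_le' (𝕜 := ℝ)
      (fun x _ => hf x) ?_ (Metric.mem_ball_self hδ) ?_
    · intro y hy
      have h1 : dist (γ + ContinuousMap.const K (y - γ s)) γ < δ := by
        rw [dist_eq_norm, add_sub_cancel_left]
        refine lt_of_le_of_lt ((ContinuousMap.norm_le _ (norm_nonneg (y - γ s))).2 ?_)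
          (mem_ball_iff_norm.1 hy)
        intro; simp
      have h2 := hball h1
      have h3 := (ContinuousMap.dist_apply_le_dist s).trans h2.le
      rw [← dist_eq_norm]
      have h4 : y = γ s + (y - γ s) := by abel
      rw [h4]
      exact h3
    · rw [mem_ball_iff_norm, add_sub_cancel_left]
      exact (h.norm_coe_le_norm s).trans_lt hh
  rw [add_sub_cancel_left] at key
  exact key.trans (mul_le_mul_of_nonneg_left (h.norm_coe_le_norm s) hc.le)

lemma nem_contDiff_nat (n : ℕ) : ∀ {E F : Type} [NormedAddCommGroup E] [NormedSpace ℝ E]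
    [NormedAddCommGroup F] [NormedSpace ℝ F] (f : C(E, F)) (_ : ContDiff ℝ n f),
    ContDiff ℝ n (nem f : C(K, E) → C(K, F)) := by
  induction n with
  | zero =>
    intro E F _ _ _ _ f _
    rw [Nat.cast_zero, contDiff_zero]
    exact ContinuousMap.continuous_postcomp _
  | succ n ih =>
    intro E F _ _ _ _ f hf
    have hf1 := hf
    rw [Nat.cast_add, Nat.cast_one, contDiff_succ_iff_fderiv] at hf1
    have hc : Continuous (fderiv ℝ f) := hf1.2.2.continuous
    rw [Nat.cast_add, Nat.cast_one, contDiff_succ_iff_hasFDerivAt]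
    have h1 : ContDiff ℝ n (fun γ : C(K, E) => famOp K E F (nem ⟨fderiv ℝ f, hc⟩ γ)) :=
      ContDiff.comp (g := famOp K E F) (ContinuousLinearMap.contDiff _)
        (ih ⟨fderiv ℝ f, hc⟩ hf1.2.2)
    exact ⟨fun γ => famOp K E F (nem ⟨fderiv ℝ f, hc⟩ γ), h1,
      fun γ => nem_hasFDerivAt f hf1.1 hc γ⟩

lemma nem_contDiff {E F : Type} [NormedAddCommGroup E] [NormedSpace ℝ E]
    [NormedAddCommGroup F] [NormedSpace ℝ F] (f : C(E, F)) (hf : ContDiff ℝ (⊤ : ℕ∞) f) :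
    ContDiff ℝ (⊤ : ℕ∞) (nem f : C(K, E) → C(K, F)) := by
  rw [contDiff_infty]
  intro n
  exact nem_contDiff_nat n f (hf.of_le (by exact_mod_cast le_top))

end Nemytskii

section InverseFunction
open Topology

/-- Inverse function theorem, smooth version on a neighbourhood. -/
lemma smooth_inverse {E F : Type} [NormedAddCommGroup E] [NormedSpace ℝ E] [CompleteSpace E]
    [NormedAddCommGroup F] [NormedSpace ℝ F] [CompleteSpace F] (H : E → F)
    (hH : ContDiff ℝ (⊤ : ℕ∞) H) (x₀ : E) (L : E ≃L[ℝ] F)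
    (hL : HasFDerivAt H (L : E →L[ℝ] F) x₀) :
    ∃ e : OpenPartialHomeomorph E F, x₀ ∈ e.source ∧ (∀ x, e x = H x) ∧
      ContDiffOn ℝ (⊤ : ℕ∞) e.symm e.target := by
  have hs : HasStrictFDerivAt H (L : E →L[ℝ] F) x₀ := by
    have := hH.contDiffAt.hasStrictFDerivAt (x := x₀) (by simp)
    rwa [hL.fderiv] at this
  let e := hs.toOpenPartialHomeomorph H
  have he : ∀ x, e x = H x := fun x => rfl
  have hcont : Continuous (fderiv ℝ H) := hH.continuous_fderiv (by simp)
  let S : Set E := (fderiv ℝ H) ⁻¹' (Set.range ((↑) : (E ≃L[ℝ] F) → (E →L[ℝ] F)))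
  have hS : IsOpen S := (ContinuousLinearEquiv.isOpen).preimage hcont
  have hxS : x₀ ∈ S := ⟨L, hL.fderiv.symm⟩
  refine ⟨e.restrOpen S hS, ⟨hs.mem_toOpenPartialHomeomorph_source, hxS⟩, he, ?_⟩
  intro y hy
  have hmem := (e.restrOpen S hS).map_target hy
  have hyS : (e.restrOpen S hS).symm y ∈ S := hmem.2
  obtain ⟨M, hM⟩ := hyS
  refine ((e.restrOpen S hS).contDiffAt_symm (f₀' := M) hy ?_ ?_).contDiffWithinAt
  · rw [hM]
    exact (hH.differentiable (by simp) _).hasFDerivAt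
  · exact hH.contDiffAt

/-- Globalization of a smooth germ. -/
lemma smooth_extend {E F : Type} [NormedAddCommGroup E] [NormedSpace ℝ E] [FiniteDimensional ℝ E]
    [NormedAddCommGroup F] [NormedSpace ℝ F] (f : E → F) (U : Set E) (hU : IsOpen U)
    (hf : ContDiffOn ℝ (⊤ : ℕ∞) f U) (x₀ : E) (hx : x₀ ∈ U) :
    ∃ g : E → F, ContDiff ℝ (⊤ : ℕ∞) g ∧ ∀ᶠ x in 𝓝 x₀, g x = f x := by
  obtain ⟨r, hr, hball⟩ := Metric.isOpen_iff.1 hU x₀ hx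
  let b : ContDiffBump x₀ := ⟨r / 4, r / 2, by linarith, by linarith⟩
  refine ⟨fun x => b x • f x, ?_, ?_⟩
  · rw [contDiff_iff_contDiffAt]
    intro x
    by_cases h : x ∈ U
    · exact b.contDiff.contDiffAt.smul (hf.contDiffAt (hU.mem_nhds h))
    · have hx' : x ∉ Metric.closedBall x₀ (r / 2) := by
        intro h'
        exact h (hball (Metric.closedBall_subset_ball (by linarith) h'))
      have : (fun x => b x • f x) =ᶠ[𝓝 x] fun _ => 0 := by
        filter_upwards [Metric.isClosed_closedBall.isOpen_compl.mem_nhds hx'] with y hy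
        have : b y = 0 := by
          apply b.zero_of_le_dist
          simp only [Set.mem_compl_iff, Metric.mem_closedBall, not_le] at hy
          exact hy.le
        simp [this]
      exact contDiffAt_const.congr_of_eventuallyEq this
  · filter_upwards [b.eventuallyEq_one] with x hx
    simp [hx]

end InverseFunction

section Flow
open Topology unitInterval

/-- integration operator on `C([0,1], E)` -/
noncomputable def intOp (E : Type) [NormedAddCommGroup E] [NormedSpace ℝ E] [CompleteSpace E] :
    C(I, E) →L[ℝ] C(I, E) :=
  LinearMap.mkContinuous
    { toFun := fun γ => ⟨fun t => ∫ s in (0:ℝ)..t, γ (Set.projIcc 0 1 zero_le_one s), by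
        have h : Continuous fun s : ℝ => γ (Set.projIcc 0 1 zero_le_one s) := by fun_prop
        exact (intervalIntegral.continuous_primitive
          (fun a b => h.intervalIntegrable a b) 0).comp continuous_subtype_val⟩
      map_add' := by
        intro γ η
        ext t
        simp only [ContinuousMap.coe_mk, ContinuousMap.add_apply]
        exact intervalIntegral.integral_add
          (Continuous.intervalIntegrable (by fun_prop) _ _)
          (Continuous.intervalIntegrable (by fun_prop) _ _)
      map_smul' := by
        intro c γ
        ext t
        simp }
    1 (by
      intro γ
      rw [ContinuousMap.norm_le _ (by positivity)]
      intro t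
      have := intervalIntegral.norm_integral_le_of_norm_le_const (a := (0:ℝ)) (b := t)
        (f := fun s => γ (Set.projIcc 0 1 zero_le_one s)) (C := ‖γ‖)
        (fun s _ => γ.norm_coe_le_norm _)
      refine this.trans ?_
      have ht : |(t:ℝ) - 0| ≤ 1 := by rw [sub_zero, abs_of_nonneg t.2.1]; exact t.2.2
      nlinarith [norm_nonneg γ])

lemma intOp_apply {E : Type} [NormedAddCommGroup E] [NormedSpace ℝ E] [CompleteSpace E]
    (γ : C(I, E)) (t : I) :
    intOp E γ t = ∫ s in (0:ℝ)..t, γ (Set.projIcc 0 1 zero_le_one s) := rfl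

noncomputable def constL (E : Type) [NormedAddCommGroup E] [NormedSpace ℝ E] : E →L[ℝ] C(I, E) :=
  ContinuousLinearMap.const ℝ I

lemma constL_apply {E : Type} [NormedAddCommGroup E] [NormedSpace ℝ E] (x : E) (t : I) :
    constL E x t = x := rfl

/-- the Picard map -/
noncomputable def picH {E : Type} [NormedAddCommGroup E] [NormedSpace ℝ E] [CompleteSpace E]
    (f : C(E, E)) (p : (E × ℝ) × C(I, E)) : (E × ℝ) × C(I, E) :=
  (p.1, p.2 - constL E p.1.1 - p.1.2 • intOp E (nem f p.2))

/-- its derivative at the constant curves, time scale `0` -/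
noncomputable def picL {E : Type} [NormedAddCommGroup E] [NormedSpace ℝ E] [CompleteSpace E]
    (w : C(I, E)) : ((E × ℝ) × C(I, E)) ≃L[ℝ] ((E × ℝ) × C(I, E)) :=
  ContinuousLinearEquiv.equivOfInverse
    ((ContinuousLinearMap.fst ℝ _ _).prod (ContinuousLinearMap.snd ℝ _ _
      - (constL E).comp ((ContinuousLinearMap.fst ℝ _ _).comp (ContinuousLinearMap.fst ℝ _ _))
      - ((ContinuousLinearMap.snd ℝ E ℝ).comp (ContinuousLinearMap.fst ℝ _ _)).smulRight w))
    ((ContinuousLinearMap.fst ℝ _ _).prod (ContinuousLinearMap.snd ℝ _ _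
      + (constL E).comp ((ContinuousLinearMap.fst ℝ _ _).comp (ContinuousLinearMap.fst ℝ _ _))
      + ((ContinuousLinearMap.snd ℝ E ℝ).comp (ContinuousLinearMap.fst ℝ _ _)).smulRight w))
    (by
      intro p
      refine Prod.ext rfl ?_
      simp
      abel)
    (by
      intro p
      refine Prod.ext rfl ?_
      simp
      abel)

lemma picH_contDiff {E : Type} [NormedAddCommGroup E] [NormedSpace ℝ E] [CompleteSpace E]
    (f : C(E, E)) (hf : ContDiff ℝ (⊤ : ℕ∞) f) : ContDiff ℝ (⊤ : ℕ∞) (picH f) := by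
  have h1 : ContDiff ℝ (⊤ : ℕ∞) (fun p : (E × ℝ) × C(I, E) => intOp E (nem f p.2)) :=
    (intOp E).contDiff.comp ((nem_contDiff f hf).comp contDiff_snd)
  have h2 : ContDiff ℝ (⊤ : ℕ∞) (fun p : (E × ℝ) × C(I, E) => constL E p.1.1) :=
    (constL E).contDiff.comp (contDiff_fst.comp contDiff_fst)
  exact contDiff_fst.prodMk ((contDiff_snd.sub h2).sub
    ((contDiff_snd.comp contDiff_fst).smul h1))

lemma picH_hasFDerivAt {E : Type} [NormedAddCommGroup E] [NormedSpace ℝ E] [CompleteSpace E]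
    (f : C(E, E)) (hf : ContDiff ℝ (⊤ : ℕ∞) f) (x₀ : E) :
    HasFDerivAt (picH f) (picL (intOp E (nem f (constL E x₀))) :
      ((E × ℝ) × C(I, E)) →L[ℝ] ((E × ℝ) × C(I, E))) ((x₀, 0), constL E x₀) := by
  have h1 : ContDiff ℝ (⊤ : ℕ∞) (fun p : (E × ℝ) × C(I, E) => intOp E (nem f p.2)) :=
    (intOp E).contDiff.comp ((nem_contDiff f hf).comp contDiff_snd)
  have h1' := (h1.differentiable (by simp) ((x₀, 0), constL E x₀)).hasFDerivAt
  have hfst : HasFDerivAt (fun p : (E × ℝ) × C(I, E) => p.1)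
    (ContinuousLinearMap.fst ℝ _ _) ((x₀, (0:ℝ)), constL E x₀) := hasFDerivAt_fst
  have hsnd : HasFDerivAt (fun p : (E × ℝ) × C(I, E) => p.2)
    (ContinuousLinearMap.snd ℝ _ _) ((x₀, (0:ℝ)), constL E x₀) := hasFDerivAt_snd
  have h2 : HasFDerivAt (fun p : (E × ℝ) × C(I, E) => constL E p.1.1)
    ((constL E).comp ((ContinuousLinearMap.fst ℝ _ _).comp (ContinuousLinearMap.fst ℝ _ _)))
    ((x₀, (0:ℝ)), constL E x₀) := ((constL E).comp ((ContinuousLinearMap.fst ℝ E ℝ).comp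
      (ContinuousLinearMap.fst ℝ (E × ℝ) C(I, E)))).hasFDerivAt
  have h3 : HasFDerivAt (fun p : (E × ℝ) × C(I, E) => p.1.2)
    ((ContinuousLinearMap.snd ℝ _ _).comp (ContinuousLinearMap.fst ℝ _ _))
    ((x₀, (0:ℝ)), constL E x₀) := ((ContinuousLinearMap.snd ℝ E ℝ).comp
      (ContinuousLinearMap.fst ℝ (E × ℝ) C(I, E))).hasFDerivAt
  refine (hfst.prodMk ((hsnd.sub h2).sub (h3.smul h1'))).congr_fderiv ?_
  ext p <;> simp [picL]

/-- Smooth local flows. -/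
theorem smooth_flow {E : Type} [NormedAddCommGroup E] [NormedSpace ℝ E] [FiniteDimensional ℝ E]
    (f : E → E) (hf : ContDiff ℝ (⊤ : ℕ∞) f) (x₀ : E) :
    ∃ Fl : E × ℝ → E, ContDiff ℝ (⊤ : ℕ∞) Fl ∧ ∃ δ > 0, ∀ x ∈ Metric.ball x₀ δ,
      Fl (x, 0) = x ∧ ∀ t ∈ Metric.ball (0:ℝ) δ,
        HasDerivAt (fun t => Fl (x, t)) (f (Fl (x, t))) t := by
  haveI : CompleteSpace E := FiniteDimensional.complete ℝ E
  let fc : C(E, E) := ⟨f, hf.continuous⟩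
  obtain ⟨e, hes, heH, hesm⟩ := smooth_inverse (picH fc) (picH_contDiff fc hf) _ _
    (picH_hasFDerivAt fc hf x₀)
  set p₀ : (E × ℝ) × C(I, E) := ((x₀, 0), constL E x₀) with hp₀
  have hp0 : picH fc p₀ = ((x₀, 0), 0) := by
    refine Prod.ext rfl ?_
    simp [picH, hp₀]
  -- the preimage of the slice
  let j : E × ℝ → (E × ℝ) × C(I, E) := fun q => (q, 0)
  have hj : ContDiff ℝ (⊤ : ℕ∞) j := contDiff_id.prodMk contDiff_const
  let T : Set (E × ℝ) := j ⁻¹' e.target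
  have hT : IsOpen T := e.open_target.preimage hj.continuous
  have hjx : j (x₀, 0) = e p₀ := by rw [heH, hp0]
  have hT0 : (x₀, (0:ℝ)) ∈ T := by
    change j (x₀, 0) ∈ e.target
    rw [hjx]; exact e.map_source hes
  let ev : C(I, E) →L[ℝ] E := ContinuousMap.evalCLM ℝ (1 : I)
  let Fl0 : E × ℝ → E := fun q => ev (e.symm (j q)).2
  have hFl0 : ContDiffOn ℝ (⊤ : ℕ∞) Fl0 T :=
    ev.contDiff.comp_contDiffOn (contDiff_snd.comp_contDiffOn
      (hesm.comp hj.contDiffOn (fun q hq => hq)))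
  obtain ⟨Fl, hFl, hFleq⟩ := smooth_extend Fl0 T hT hFl0 _ hT0
  obtain ⟨r, hr, hrs⟩ := Metric.isOpen_iff.1 e.open_source p₀ hes
  have hcs : ContinuousAt (fun q => e.symm (j q)) (x₀, (0:ℝ)) := by
    refine ContinuousAt.comp (g := e.symm) ?_ hj.continuous.continuousAt
    exact e.symm.continuousAt hT0
  have hcs0 : e.symm (j (x₀, 0)) = p₀ := by rw [hjx, e.left_inv hes]
  have hev : ∀ᶠ q in 𝓝 (x₀, (0:ℝ)), Fl q = Fl0 q ∧ q ∈ T ∧ dist (e.symm (j q)) p₀ < r := by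
    refine hFleq.and (Filter.Eventually.and (hT.eventually_mem hT0) ?_)
    have := hcs.eventually (Metric.ball_mem_nhds _ hr)
    simp only [hcs0] at this
    exact this
  obtain ⟨δ0, hδ0, hδ⟩ := Metric.eventually_nhds_iff_ball.1 hev
  refine ⟨Fl, hFl, min δ0 r, lt_min hδ0 hr, ?_⟩
  intro x hx
  -- facts about the curve
  have main : ∀ t ∈ Metric.ball (0:ℝ) (min δ0 r), Fl (x, t) = x + ∫ s in (0:ℝ)..t, f (Fl (x, s)) := by
    intro t ht
    have hmem : ∀ s : I, (x, t * (s:ℝ)) ∈ Metric.ball (x₀, (0:ℝ)) (min δ0 r) := by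
      intro s
      rw [Metric.mem_ball, Prod.dist_eq, max_lt_iff]
      refine ⟨hx, ?_⟩
      rw [Metric.mem_ball, dist_zero_right] at ht
      rw [dist_zero_right, norm_mul]
      refine lt_of_le_of_lt ?_ ht
      have : ‖(s:ℝ)‖ ≤ 1 := by rw [Real.norm_eq_abs, abs_of_nonneg s.2.1]; exact s.2.2
      nlinarith [norm_nonneg t]
    have hmemT : ∀ s : I, (x, t * (s:ℝ)) ∈ Metric.ball (x₀, (0:ℝ)) δ0 := fun s =>
      Metric.ball_subset_ball (min_le_left _ _) (hmem s)
    have hxt : (x, t) ∈ Metric.ball (x₀, (0:ℝ)) δ0 := by simpa using hmemT 1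
    obtain ⟨hA, hB, hC⟩ := hδ _ hxt
    set q := e.symm (j (x, t)) with hq
    have hHq : picH fc q = j (x, t) := by rw [← heH, hq, e.right_inv hB]
    have hq1 : q.1 = (x, t) := congrArg Prod.fst hHq
    have hq2 : q.2 - constL E x - t • intOp E (nem fc q.2) = 0 := by
      have := congrArg Prod.snd hHq
      simp only [picH, hq1] at this
      exact this
    have hq2s : ∀ s : I, q.2 s = x + t • ∫ z in (0:ℝ)..s, f (q.2 (Set.projIcc 0 1 zero_le_one z)) := by
      intro s
      have := congrArg (fun γ : C(I, E) => γ s) hq2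
      simp only [ContinuousMap.sub_apply, ContinuousMap.smul_apply, ContinuousMap.zero_apply,
        constL_apply, intOp_apply] at this
      rw [sub_sub, sub_eq_zero] at this
      exact this
    -- rescaled curves
    have hFls : ∀ s : I, Fl (x, t * (s:ℝ)) = q.2 s := by
      intro s
      let γs : C(I, E) := ⟨fun τ => q.2 (s * τ), by fun_prop⟩
      have hd : dist ((x, t * (s:ℝ)), γs) p₀ < r := by
        rw [Prod.dist_eq, max_lt_iff]
        refine ⟨Metric.ball_subset_ball (min_le_right _ _) (hmem s), ?_⟩
        have hd2 : dist q.2 (constL E x₀) < r := lt_of_le_of_lt (le_max_right _ _) hC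
        refine lt_of_le_of_lt ?_ hd2
        rw [ContinuousMap.dist_le dist_nonneg]
        intro τ
        exact ContinuousMap.dist_apply_le_dist (f := q.2) (g := constL E x₀) (s * τ)
      have hHs : picH fc ((x, t * (s:ℝ)), γs) = j (x, t * (s:ℝ)) := by
        refine Prod.ext rfl ?_
        change γs - constL E x - (t * (s:ℝ)) • intOp E (nem fc γs) = 0
        ext τ
        simp only [ContinuousMap.sub_apply, ContinuousMap.smul_apply, ContinuousMap.zero_apply,
          constL_apply, intOp_apply]
        rw [sub_sub, sub_eq_zero]
        change q.2 (s * τ) = x + (t * (s:ℝ)) • ∫ z in (0:ℝ)..τ,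
          f (q.2 (s * Set.projIcc 0 1 zero_le_one z))
        rw [hq2s (s * τ), mul_smul]
        congr 2
        have hsub := intervalIntegral.smul_integral_comp_mul_left (a := (0:ℝ)) (b := (τ:ℝ))
          (fun z => f (q.2 (Set.projIcc 0 1 zero_le_one z))) (s:ℝ)
        rw [mul_zero] at hsub
        rw [show ((s * τ : I) : ℝ) = (s:ℝ) * τ from rfl, ← hsub]
        congr 1
        apply intervalIntegral.integral_congr
        intro z hz
        rw [Set.uIcc_of_le τ.2.1] at hz
        have hz' : z ∈ Set.Icc (0:ℝ) 1 := ⟨hz.1, hz.2.trans τ.2.2⟩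
        have hsz : (s:ℝ) * z ∈ Set.Icc (0:ℝ) 1 := (s * ⟨z, hz'⟩ : I).2
        simp only
        rw [Set.projIcc_of_mem _ hz', Set.projIcc_of_mem _ hsz]
        rfl
      have h4 : e.symm (j (x, t * (s:ℝ))) = ((x, t * (s:ℝ)), γs) := by
        rw [← hHs, ← heH, e.left_inv (hrs hd)]
      rw [(hδ _ (hmemT s)).1]
      change (e.symm (j (x, t * (s:ℝ)))).2 1 = q.2 s
      rw [h4]
      change q.2 (s * 1) = q.2 s
      rw [mul_one]
    have h5 := hq2s 1
    rw [← hFls 1] at h5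
    rw [show ((1 : I) : ℝ) = 1 from rfl, mul_one] at h5
    rw [h5]
    congr 1
    have hsub := intervalIntegral.smul_integral_comp_mul_left (a := (0:ℝ)) (b := (1:ℝ))
          (fun z => f (Fl (x, z))) t
    rw [mul_zero, mul_one] at hsub
    rw [← hsub]
    congr 1
    apply intervalIntegral.integral_congr
    intro z hz
    rw [Set.uIcc_of_le zero_le_one] at hz
    simp only
    rw [Set.projIcc_of_mem _ hz, ← hFls ⟨z, hz⟩]
  have hcont : Continuous (fun s : ℝ => f (Fl (x, s))) :=
    hf.continuous.comp (hFl.continuous.comp (by fun_prop))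
  refine ⟨?_, ?_⟩
  · rw [main 0 (Metric.mem_ball_self (lt_min hδ0 hr))]
    simp
  · intro t ht
    have h1 : HasDerivAt (fun t => x + ∫ s in (0:ℝ)..t, f (Fl (x, s))) (f (Fl (x, t))) t :=
      (intervalIntegral.integral_hasDerivAt_right (hcont.intervalIntegrable _ _)
        (hcont.stronglyMeasurableAtFilter _ _) hcont.continuousAt).const_add x
    refine h1.congr_of_eventuallyEq ?_
    filter_upwards [Metric.isOpen_ball.mem_nhds ht] with s hs
    exact main s hs

/-- Averaging a smooth function along segments gives a smooth function. -/
lemma smooth_average {E : Type} [NormedAddCommGroup E] [NormedSpace ℝ E]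
    (f : E → ℝ) (hf : ContDiff ℝ (⊤ : ℕ∞) f) (A B : E →L[ℝ] E) :
    ContDiff ℝ (⊤ : ℕ∞) (fun x => ∫ t in (0:ℝ)..1, f (A x + t • B x)) := by
  let fc : C(E, ℝ) := ⟨f, hf.continuous⟩
  let idc : C(I, ℝ) := ⟨fun t => (t:ℝ), continuous_subtype_val⟩
  let m : C(I, ℝ →L[ℝ] E →L[ℝ] E) := ContinuousMap.const I (ContinuousLinearMap.lsmul ℝ ℝ)
  let G : E → C(I, E) := fun x => constL E (A x) +
    famOp I ℝ E ⟨fun _ => ContinuousLinearMap.toSpanSingleton ℝ (B x), by fun_prop⟩ idc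
  have hG : ContDiff ℝ (⊤ : ℕ∞) G := by
    have hlin : IsLinearMap ℝ (fun y : E =>
        famOp I ℝ E ⟨fun _ => ContinuousLinearMap.toSpanSingleton ℝ y, by fun_prop⟩ idc) :=
      ⟨by intro y z; ext t; simp [famOp_apply], by
        intro c y; ext t; simp [famOp_apply]; exact smul_comm _ _ _⟩
    let ℓ : E →L[ℝ] C(I, E) := LinearMap.mkContinuous (hlin.mk' _) 1 (by
      intro y
      rw [ContinuousMap.norm_le _ (by positivity)]
      intro t
      simp only [IsLinearMap.mk'_apply, famOp_apply]
      simp only [ContinuousMap.coe_mk, ContinuousLinearMap.toSpanSingleton_apply, norm_smul]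
      have : ‖idc t‖ ≤ 1 := by
        change ‖(t:ℝ)‖ ≤ 1
        rw [Real.norm_eq_abs, abs_of_nonneg t.2.1]; exact t.2.2
      nlinarith [norm_nonneg y])
    exact ((constL E).contDiff.comp A.contDiff).add (ℓ.contDiff.comp B.contDiff)
  let ev : C(I, ℝ) →L[ℝ] ℝ := ContinuousMap.evalCLM ℝ (1 : I)
  have h := ev.contDiff.comp ((intOp ℝ).contDiff.comp ((nem_contDiff fc hf).comp hG))
  convert h using 1
  ext x
  change _ = ∫ s in (0:ℝ)..((1 : I) : ℝ), (nem fc (G x)) (Set.projIcc 0 1 zero_le_one s)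
  rw [show ((1 : I) : ℝ) = 1 from rfl]
  apply intervalIntegral.integral_congr
  intro z hz
  rw [Set.uIcc_of_le zero_le_one] at hz
  simp only
  rw [Set.projIcc_of_mem _ hz]
  rfl

end Flow

section Forms
open Topology

local notation "Sm" => ContDiff ℝ (⊤ : ℕ∞)

lemma Sm.coord {n : ℕ} {f : Pt → Fin n → ℝ} (h : Sm f) (j : Fin n) : Sm (fun y => f y j) :=
  contDiff_pi.1 h j

lemma Sm.coord2 {B : Form2} (h : Sm B) (i j : Fin 4) : Sm (fun y => B y i j) :=
  contDiff_pi.1 (contDiff_pi.1 h i) j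

lemma Sm.diffAt {f : Pt → ℝ} (h : Sm f) (x : Pt) : DifferentiableAt ℝ f x :=
  h.differentiable (by simp) x

lemma pd_smooth {f : Pt → ℝ} (h : Sm f) (i : Fin 4) : Sm (pd i f) := by
  have h1 : Sm (fderiv ℝ f) := h.fderiv_right (by simp)
  exact h1.clm_apply contDiff_const

lemma pd_add {f g : Pt → ℝ} (hf : Sm f) (hg : Sm g) (i : Fin 4) (x : Pt) :
    pd i (fun y => f y + g y) x = pd i f x + pd i g x := by
  simp only [pd]; rw [fderiv_fun_add (Sm.diffAt hf x) (Sm.diffAt hg x)]; rfl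

lemma pd_sub {f g : Pt → ℝ} (hf : Sm f) (hg : Sm g) (i : Fin 4) (x : Pt) :
    pd i (fun y => f y - g y) x = pd i f x - pd i g x := by
  simp only [pd]; rw [fderiv_fun_sub (Sm.diffAt hf x) (Sm.diffAt hg x)]; rfl

lemma pd_mul {f g : Pt → ℝ} (hf : Sm f) (hg : Sm g) (i : Fin 4) (x : Pt) :
    pd i (fun y => f y * g y) x = pd i f x * g x + f x * pd i g x := by
  simp only [pd]; rw [fderiv_fun_mul (Sm.diffAt hf x) (Sm.diffAt hg x)]
  simp; ring

lemma pd_neg {f : Pt → ℝ} (i : Fin 4) (x : Pt) :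
    pd i (fun y => - f y) x = - pd i f x := by
  simp only [pd]; rw [fderiv_fun_neg]; rfl

lemma pd_const (c : ℝ) (i : Fin 4) (x : Pt) : pd i (fun _ => c) x = 0 := by
  simp [pd]

lemma pd_proj (i j : Fin 4) (x : Pt) : pd i (fun y => y j) x = if j = i then 1 else 0 := by
  simp only [pd]
  have : fderiv ℝ (fun y : Pt => y j) x = ContinuousLinearMap.proj j :=
    (ContinuousLinearMap.proj (R := ℝ) (φ := fun _ : Fin 4 => ℝ) j).fderiv
  rw [this]; simp [Pi.single_apply]

lemma pd_sum {ι : Type} (s : Finset ι) {f : ι → Pt → ℝ} (hf : ∀ a, Sm (f a)) (i : Fin 4) (x : Pt) :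
    pd i (fun y => ∑ a ∈ s, f a y) x = ∑ a ∈ s, pd i (f a) x := by
  simp only [pd]
  rw [fderiv_fun_sum (fun a _ => Sm.diffAt (hf a) x)]
  simp

lemma pd_congr {f g : Pt → ℝ} {x : Pt} (h : ∀ᶠ y in 𝓝 x, f y = g y) (i : Fin 4) :
    pd i f x = pd i g x := by
  simp only [pd]; rw [Filter.EventuallyEq.fderiv_eq h]

lemma pd_congr_ev {f g : Pt → ℝ} {x : Pt} (h : ∀ᶠ y in 𝓝 x, f y = g y) (i : Fin 4) :
    ∀ᶠ y in 𝓝 x, pd i f y = pd i g y := by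
  filter_upwards [h.eventually_nhds] with y hy using pd_congr hy i

lemma pd_comm {f : Pt → ℝ} (h : Sm f) (i j : Fin 4) (x : Pt) :
    pd i (pd j f) x = pd j (pd i f) x := by
  have hs : IsSymmSndFDerivAt ℝ f x := (h.contDiffAt).isSymmSndFDerivAt
    (by simp only [minSmoothness_of_isRCLikeNormedField]; exact (WithTop.coe_le_coe.2 (le_top : (2 : ℕ∞) ≤ ⊤)))
  have h1 : DifferentiableAt ℝ (fderiv ℝ f) x :=
    (h.fderiv_right (m := (⊤ : ℕ∞)) (by simp)).differentiable (by simp) x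
  have key : ∀ a b : Fin 4, pd a (pd b f) x
      = fderiv ℝ (fderiv ℝ f) x (Pi.single a 1) (Pi.single b 1) := by
    intro a b
    change fderiv ℝ (fun y => fderiv ℝ f y (Pi.single b 1)) x (Pi.single a 1) = _
    rw [fderiv_clm_apply h1 (differentiableAt_const _)]
    simp
  rw [key, key]
  exact hs _ _

/-- directional expansions -/
lemma fderiv_eq_sum (f : Pt → ℝ) (x v : Pt) :
    fderiv ℝ f x v = ∑ i, v i * pd i f x := by
  conv_lhs => rw [pi_eq_sum_univ' v]
  simp [pd]

lemma pd_comp {f : Pt → ℝ} {φ : Pt → Pt} (hf : Sm f) (hφ : Sm φ) (i : Fin 4) (x : Pt) :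
    pd i (fun y => f (φ y)) x = ∑ a, pd a f (φ x) * pd i (fun y => φ y a) x := by
  have h1 : fderiv ℝ (fun y => f (φ y)) x = (fderiv ℝ f (φ x)).comp (fderiv ℝ φ x) :=
    fderiv_comp x (Sm.diffAt hf _) (hφ.differentiable (by simp) x)
  have h2 : ∀ a, fderiv ℝ φ x (Pi.single i 1) a = pd i (fun y => φ y a) x := by
    intro a
    have := hasFDerivAt_pi'.1 (hφ.differentiable (by simp) x).hasFDerivAt a
    simp only [pd]
    rw [this.fderiv]; rfl
  simp only [pd] at *
  rw [h1, ContinuousLinearMap.comp_apply, fderiv_eq_sum]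
  refine Finset.sum_congr rfl fun a _ => ?_
  rw [h2 a, mul_comm]; rfl

/-- Jacobian matrix. -/
noncomputable def Jm (φ : Pt → Pt) (x : Pt) : Matrix (Fin 4) (Fin 4) ℝ :=
  fun a i => pd i (fun y => φ y a) x

lemma Jm_comp {φ ψ : Pt → Pt} (hφ : Sm φ) (hψ : Sm ψ) (x : Pt) :
    Jm (fun y => φ (ψ y)) x = Jm φ (ψ x) * Jm ψ x := by
  ext a i
  rw [Matrix.mul_apply]
  exact pd_comp (Sm.coord hφ a) hψ i x

/-- pullback of 3-forms -/
noncomputable def pull3 (φ : Pt → Pt) (C : Form3) : Form3 := fun x i j k =>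
  ∑ a, ∑ b, ∑ c, C (φ x) a b c * Jm φ x a i * Jm φ x b j * Jm φ x c k

lemma pull1_smooth {φ : Pt → Pt} {a : Form1} (hφ : Sm φ) (ha : Sm a) : Sm (pull1 φ a) := by
  refine contDiff_pi.2 fun i => ?_
  refine ContDiff.sum fun b _ => ?_
  exact ((Sm.coord ha b).comp hφ).mul (pd_smooth (Sm.coord hφ b) i)

lemma pull2_smooth {φ : Pt → Pt} {A : Form2} (hφ : Sm φ) (hA : Sm A) : Sm (pull2 φ A) := by
  refine contDiff_pi.2 fun i => contDiff_pi.2 fun j => ?_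
  refine ContDiff.sum fun b _ => ContDiff.sum fun c _ => ?_
  exact (((Sm.coord2 hA b c).comp hφ).mul (pd_smooth (Sm.coord hφ b) i)).mul
    (pd_smooth (Sm.coord hφ c) j)

lemma d1_smooth {a : Form1} (ha : Sm a) : Sm (d1 a) := by
  refine contDiff_pi.2 fun i => contDiff_pi.2 fun j => ?_
  exact (pd_smooth (Sm.coord ha j) i).sub (pd_smooth (Sm.coord ha i) j)

lemma pull1_eq (φ : Pt → Pt) (a : Form1) (x : Pt) (i : Fin 4) :
    pull1 φ a x i = ∑ b, a (φ x) b * Jm φ x b i := rfl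

lemma pull2_eq (φ : Pt → Pt) (A : Form2) (x : Pt) (i j : Fin 4) :
    pull2 φ A x i j = ∑ a, ∑ b, A (φ x) a b * Jm φ x a i * Jm φ x b j := rfl

lemma pull2_mat (φ : Pt → Pt) (A : Form2) (x : Pt) :
    Matrix.of (pull2 φ A x) = (Jm φ x).transpose * Matrix.of (A (φ x)) * Jm φ x := by
  ext i j
  simp only [Matrix.of_apply, Matrix.mul_apply, Matrix.transpose_apply, pull2_eq,
    Fin.sum_univ_four]
  ring

lemma pull1_mat (φ : Pt → Pt) (a : Form1) (x : Pt) :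
    pull1 φ a x = Matrix.vecMul (a (φ x)) (Jm φ x) := by
  ext i
  rfl

lemma pull1_comp {φ ψ : Pt → Pt} (hφ : Sm φ) (hψ : Sm ψ) (a : Form1) :
    pull1 (fun y => φ (ψ y)) a = pull1 ψ (pull1 φ a) := by
  ext x : 1
  rw [pull1_mat, pull1_mat, pull1_mat, Jm_comp hφ hψ, Matrix.vecMul_vecMul]

lemma pull2_comp {φ ψ : Pt → Pt} (hφ : Sm φ) (hψ : Sm ψ) (A : Form2) :
    pull2 (fun y => φ (ψ y)) A = pull2 ψ (pull2 φ A) := by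
  ext x : 1
  apply Matrix.of.injective
  rw [pull2_mat, pull2_mat, pull2_mat, Jm_comp hφ hψ, Matrix.transpose_mul]
  simp only [Matrix.mul_assoc]

lemma pd_pull1 {φ : Pt → Pt} {a : Form1} (hφ : Sm φ) (ha : Sm a) (i j : Fin 4) (x : Pt) :
    pd i (fun y => pull1 φ a y j) x = ∑ b, ((∑ c, pd c (fun y => a y b) (φ x) * Jm φ x c i)
      * Jm φ x b j + a (φ x) b * pd i (pd j (fun y => φ y b)) x) := by
  have h0 : ∀ b, Sm (fun y => a (φ y) b) := fun b => (Sm.coord ha b).comp hφ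
  have h1 : ∀ b, Sm (pd j (fun y => φ y b)) := fun b => pd_smooth (Sm.coord hφ b) j
  change pd i (fun y => ∑ b, a (φ y) b * pd j (fun z => φ z b) y) x = _
  rw [pd_sum _ (fun b => (h0 b).mul (h1 b))]
  refine Finset.sum_congr rfl fun b _ => ?_
  rw [pd_mul (h0 b) (h1 b), pd_comp (Sm.coord ha b) hφ]
  rfl

lemma pull2_d1 {φ : Pt → Pt} {a : Form1} (hφ : Sm φ) (ha : Sm a) :
    d1 (pull1 φ a) = pull2 φ (d1 a) := by
  ext x i j
  simp only [d1]
  rw [pd_pull1 hφ ha, pd_pull1 hφ ha, pull2_eq]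
  have hc : ∀ b, pd i (pd j (fun y => φ y b)) x = pd j (pd i (fun y => φ y b)) x :=
    fun b => pd_comm (Sm.coord hφ b) i j x
  simp only [hc, d1]
  generalize Jm φ x = J
  simp only [Fin.sum_univ_four]
  ring

lemma pd_pull2 {φ : Pt → Pt} {A : Form2} (hφ : Sm φ) (hA : Sm A) (i j k : Fin 4) (x : Pt) :
    pd i (fun y => pull2 φ A y j k) x = ∑ a, ∑ b, ((∑ c, pd c (fun y => A y a b) (φ x) * Jm φ x c i)
      * Jm φ x a j * Jm φ x b k + A (φ x) a b * pd i (pd j (fun y => φ y a)) x * Jm φ x b k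
      + A (φ x) a b * Jm φ x a j * pd i (pd k (fun y => φ y b)) x) := by
  have h0 : ∀ a b, Sm (fun y => A (φ y) a b) := fun a b => (Sm.coord2 hA a b).comp hφ
  have h1 : ∀ j b, Sm (pd j (fun y => φ y b)) := fun j b => pd_smooth (Sm.coord hφ b) j
  change pd i (fun y => ∑ a, ∑ b, A (φ y) a b * pd j (fun z => φ z a) y
    * pd k (fun z => φ z b) y) x = _
  rw [pd_sum _ (fun a => ContDiff.sum fun b _ => ((h0 a b).mul (h1 j a)).mul (h1 k b))]
  refine Finset.sum_congr rfl fun a _ => ?_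
  rw [pd_sum _ (fun b => ((h0 a b).mul (h1 j a)).mul (h1 k b))]
  refine Finset.sum_congr rfl fun b _ => ?_
  rw [pd_mul ((h0 a b).mul (h1 j a)) (h1 k b), pd_mul (h0 a b) (h1 j a),
    pd_comp (Sm.coord2 hA a b) hφ]
  simp only [Jm]
  ring

lemma pull3_d2 {φ : Pt → Pt} {A : Form2} (hφ : Sm φ) (hA : Sm A) (x : Pt)
    (hAa : ∀ i j, A (φ x) i j = - A (φ x) j i) :
    d2 (pull2 φ A) x = pull3 φ (d2 A) x := by
  ext i j k
  simp only [d2]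
  rw [pd_pull2 hφ hA, pd_pull2 hφ hA, pd_pull2 hφ hA]
  have hc : ∀ i j b, pd i (pd j (fun y => φ y b)) x = pd j (pd i (fun y => φ y b)) x :=
    fun i j b => pd_comm (Sm.coord hφ b) i j x
  simp only [pull3, d2, hc j i, hc k i, hc k j]
  generalize hB : A (φ x) = B at hAa
  generalize Jm φ x = J
  obtain ⟨C, hC⟩ : ∃ C : Fin 4 → Fin 4 → ℝ, B = fun a b => C a b - C b a :=
    ⟨fun a b => B a b / 2, by ext a b; rw [hAa a b]; have := hAa a b; linarith⟩
  subst hC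
  simp only [Fin.sum_univ_four]
  ring

lemma pull3_w12 (φ : Pt → Pt) (a : Form1) (A : Form2) (x : Pt) :
    w12 (pull1 φ a) (pull2 φ A) x = pull3 φ (w12 a A) x := by
  ext i j k
  simp only [w12, pull3, pull1_eq, pull2_eq]
  generalize Jm φ x = J
  generalize A (φ x) = B
  generalize a (φ x) = c
  simp only [Fin.sum_univ_four]
  ring

end Forms

section FlowBox
open Topology

local notation "Sm" => ContDiff ℝ (⊤ : ℕ∞)

lemma hasDerivAt_line {f : Pt → ℝ} (hf : Sm f) (i : Fin 4) (x : Pt) (t : ℝ) :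
    HasDerivAt (fun t => f (Function.update x i t)) (pd i f (Function.update x i t)) t := by
  have h1 : HasDerivAt (fun t => Function.update x i t) (Pi.single i 1) t :=
    hasDerivAt_update x i t
  exact (Sm.diffAt hf _).hasFDerivAt.comp_hasDerivAt t h1

lemma hasDerivAt_line_self {f : Pt → ℝ} (hf : Sm f) (i : Fin 4) (x : Pt) :
    HasDerivAt (fun t => f (Function.update x i t)) (pd i f x) (x i) := by
  have := hasDerivAt_line hf i x (x i)
  rwa [Function.update_eq_self] at this

lemma update_mem_ball {x : Pt} {ε t : ℝ} (hx : x ∈ Metric.ball (0 : Pt) ε)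
    (i : Fin 4) (ht : t ∈ Metric.ball (0:ℝ) ε) : Function.update x i t ∈ Metric.ball (0 : Pt) ε := by
  have hε : 0 < ε := lt_of_le_of_lt dist_nonneg hx
  rw [Metric.mem_ball, dist_pi_lt_iff hε] at *
  intro b
  by_cases h : b = i
  · subst h; simpa using ht
  · simpa [Function.update_of_ne h] using hx b

lemma const_of_pd_zero {f : Pt → ℝ} (hf : Sm f) (i : Fin 4)
    (h : ∀ᶠ x in 𝓝 (0 : Pt), pd i f x = 0) :
    ∀ᶠ x in 𝓝 (0 : Pt), f x = f (Function.update x i 0) := by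
  obtain ⟨ε, hε, hb⟩ := Metric.eventually_nhds_iff_ball.1 h
  filter_upwards [Metric.ball_mem_nhds _ hε] with x hx
  have hxi : x i ∈ Metric.ball (0:ℝ) ε := by
    rw [Metric.mem_ball, dist_pi_lt_iff hε] at hx
    exact hx i
  have key := Metric.isOpen_ball.is_const_of_deriv_eq_zero
    (convex_ball (0:ℝ) ε).isPreconnected
    (f := fun t => f (Function.update x i t))
    (fun t _ => (hasDerivAt_line hf i x t).differentiableAt.differentiableWithinAt)
    (fun t ht => by
      rw [(hasDerivAt_line hf i x t).deriv]
      exact hb _ (update_mem_ball hx i ht)) hxi (Metric.mem_ball_self hε)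
  simpa using key

lemma pd_slice {f g : Pt → ℝ} (hf : Sm f) (hg : Sm g) {i j : Fin 4} (hij : j ≠ i)
    (h : ∀ᶠ y in 𝓝 (0 : Pt), y i = 0 → f y = g y) :
    ∀ᶠ x in 𝓝 (0 : Pt), x i = 0 → pd j f x = pd j g x := by
  filter_upwards [h.eventually_nhds] with x hx hxi
  have hc : Tendsto (fun t => Function.update x j t) (𝓝 (x j)) (𝓝 x) := by
    have : Continuous (fun t => Function.update x j t) := by fun_prop
    have h2 := this.tendsto (x j)
    rwa [Function.update_eq_self] at h2
  have h1 : (fun t => f (Function.update x j t)) =ᶠ[𝓝 (x j)]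
      fun t => g (Function.update x j t) := by
    filter_upwards [hc.eventually hx] with t ht
    apply ht
    rw [Function.update_of_ne hij.symm]; exact hxi
  exact (hasDerivAt_line_self hf j x).unique
    ((hasDerivAt_line_self hg j x).congr_of_eventuallyEq h1)

lemma ext_div {f g : Pt → ℝ} (hf : Sm f) (hg : Sm g) {x0 : Pt} (h : g x0 ≠ 0) :
    ∃ q : Pt → ℝ, Sm q ∧ ∀ᶠ x in 𝓝 x0, q x * g x = f x := by
  have hU : IsOpen {x | g x ≠ 0} := isOpen_ne_fun hg.continuous continuous_const
  obtain ⟨q, hq, hqe⟩ := smooth_extend (fun x => f x / g x) _ hU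
    (hf.contDiffOn.div hg.contDiffOn (fun x hx => hx)) x0 h
  refine ⟨q, hq, ?_⟩
  filter_upwards [hqe, hU.eventually_mem h] with x h1 h2
  rw [h1, div_mul_cancel₀ _ h2]

/-- Straightening of a vector field. -/
theorem flowbox (v : Pt → Pt) (hv : Sm v) (x0 : Pt) (i k : Fin 4) (hk : v x0 k ≠ 0)
    (S : Finset (Fin 4)) (hi : i ∉ S) (hkS : k ∉ S) (hS0 : ∀ x, ∀ j ∈ S, v x j = 0)
    (hS : ∀ x y : Pt, (∀ j, j ∉ S → x j = y j) → v x = v y) :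
    ∃ φ : Pt → Pt, Sm φ ∧ φ 0 = x0 ∧ (Jm φ 0).det ≠ 0 ∧ ∀ᶠ x in 𝓝 (0 : Pt),
      (∀ l, Jm φ x l i = v (φ x) l) ∧
      (∀ j ∈ S, ∀ l, Jm φ x l j = if l = j then 1 else 0) ∧
      (∀ l c, (∀ y, v y l = c) → φ x l = x0 l + c * x i
        + (if Equiv.swap i k l = i then 0 else x (Equiv.swap i k l))) ∧
      (x i = 0 → ∀ l, φ x l = x0 l + x (Equiv.swap i k l)) ∧
      (x i = 0 → ∀ j, j ≠ i → ∀ l, Jm φ x l j = if Equiv.swap i k l = j then 1 else 0) := by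
  classical
  obtain ⟨Fl, hFl, δ, hδ, hflow⟩ := smooth_flow v hv x0
  let s : Fin 4 → Fin 4 := fun l => Equiv.swap i k l
  have hsS : ∀ l, l ∈ S → s l = l := by
    intro l hl
    exact Equiv.swap_apply_of_ne_of_ne (fun h => hi (h ▸ hl)) (fun h => hkS (h ▸ hl))
  have hss : ∀ l, s (s l) = l := fun l => Equiv.swap_apply_self i k l
  have hsk : s k = i := Equiv.swap_apply_right i k
  have hsS' : ∀ l, l ∉ S → s l ∉ S := by
    intro l hl h
    have := hsS _ h
    rw [hss] at this
    exact hl (this ▸ h)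
  let b : Pt → Pt := fun x l => x0 l + (if s l = i ∨ s l ∈ S then 0 else x (s l))
  let r : Pt → Pt := fun x l => if l ∈ S then x l else 0
  have hb : Sm b := by
    refine contDiff_pi.2 fun l => ?_
    by_cases h : s l = i ∨ s l ∈ S
    · simp only [b, if_pos h]; exact contDiff_const
    · simp only [b, if_neg h]; exact contDiff_const.add (contDiff_apply _ _ _)
  have hr : Sm r := by
    refine contDiff_pi.2 fun l => ?_
    by_cases h : l ∈ S
    · simp only [r, if_pos h]; exact contDiff_apply _ _ _
    · simp only [r, if_neg h]; exact contDiff_const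
  let φ : Pt → Pt := fun x => Fl (b x, x i) + r x
  have hφ : Sm φ := (hFl.comp (hb.prodMk (contDiff_apply ℝ ℝ i))).add hr
  have hb0 : b 0 = x0 := by ext l; simp [b]
  have hr0 : r 0 = 0 := by ext l; simp [r]
  have hbr : ∀ x l, b x l + r x l = x0 l + (if s l = i then 0 else x (s l)) := by
    intro x l
    by_cases hl : l ∈ S
    · have h1 : s l ≠ i := by rw [hsS l hl]; exact fun h => hi (h ▸ hl)
      simp [b, r, hsS l hl, hl]
      intro h; exact absurd (h ▸ hl) hi
    · simp [b, r, hsS' l hl, hl]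
  have hev : ∀ᶠ x in 𝓝 (0 : Pt), b x ∈ Metric.ball x0 δ ∧ x i ∈ Metric.ball (0:ℝ) δ := by
    refine Filter.Eventually.and ?_ ?_
    · have := hb.continuous.tendsto 0
      rw [hb0] at this
      exact this.eventually (Metric.ball_mem_nhds _ hδ)
    · have := (continuous_apply (A := fun _ : Fin 4 => ℝ) i).tendsto 0
      exact this.eventually (Metric.ball_mem_nhds _ hδ)
  have hslice : ∀ x, b x ∈ Metric.ball x0 δ → x i = 0 → ∀ l, φ x l = x0 l + x (s l) := by
    intro x hx hxi l
    change Fl (b x, x i) l + r x l = _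
    rw [hxi, (hflow _ hx).1, hbr]
    split_ifs with h
    · rw [h, hxi]
    · rfl
  have hJs : ∀ᶠ x in 𝓝 (0 : Pt), x i = 0 → ∀ j, j ≠ i → ∀ l,
      Jm φ x l j = if s l = j then 1 else 0 := by
    have : ∀ j, ∀ l, ∀ᶠ x in 𝓝 (0 : Pt), x i = 0 → j ≠ i →
        Jm φ x l j = if s l = j then 1 else 0 := by
      intro j l
      by_cases hj : j = i
      · filter_upwards with x _ h using absurd hj h
      have := pd_slice (f := fun y => φ y l) (g := fun y => x0 l + y (s l)) (Sm.coord hφ l)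
        (contDiff_const.add (contDiff_apply _ _ _)) hj
        (hev.mono fun x hx hxi => hslice x hx.1 hxi l)
      filter_upwards [this] with x hx hxi _
      rw [Jm, hx hxi, pd_add contDiff_const (contDiff_apply _ _ _), pd_const, pd_proj, zero_add]
    have h2 := eventually_all.2 fun j => eventually_all.2 fun l => this j l
    filter_upwards [h2] with x hx hxi j hj l using hx j l hxi hj
  have hmain : ∀ᶠ x in 𝓝 (0 : Pt),
      (∀ l, Jm φ x l i = v (φ x) l) ∧
      (∀ j ∈ S, ∀ l, Jm φ x l j = if l = j then 1 else 0) ∧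
      (∀ l c, (∀ y, v y l = c) → φ x l = x0 l + c * x i
        + (if s l = i then 0 else x (s l))) ∧
      (x i = 0 → ∀ l, φ x l = x0 l + x (s l)) ∧
      (x i = 0 → ∀ j, j ≠ i → ∀ l, Jm φ x l j = if s l = j then 1 else 0) := by
    filter_upwards [hev, hJs] with x hx hxJ
    refine ⟨?_, ?_, ?_, hslice x hx.1, hxJ⟩
    · intro l
      have h1 := hasDerivAt_line_self (Sm.coord hφ l) i x
      have h2 : (fun t => φ (Function.update x i t) l) = fun t => Fl (b x, t) l + r x l := by
        ext t
        have hb' : b (Function.update x i t) = b x := by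
          ext l
          simp only [b]
          split_ifs with h
          · rfl
          · push Not at h
            rw [Function.update_of_ne h.1]
        have hr' : r (Function.update x i t) = r x := by
          ext l
          simp only [r]
          split_ifs with h
          · rw [Function.update_of_ne (fun hh : l = i => hi (hh ▸ h))]
          · rfl
        change Fl (b (Function.update x i t), Function.update x i t i) l
          + r (Function.update x i t) l = _
        rw [hb', hr', Function.update_self]
      rw [h2] at h1
      have h3 := hasDerivAt_pi.1 ((hflow _ hx.1).2 _ hx.2) l
      have h4 : v (Fl (b x, x i)) = v (φ x) := by
        apply hS
        intro j hj
        simp [φ, r, hj]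
      rw [h4] at h3
      exact h1.unique (h3.add_const _)
    · intro j hj l
      have hji : j ≠ i := fun h => hi (h ▸ hj)
      have h1 := hasDerivAt_line_self (Sm.coord hφ l) j x
      have h2 : (fun t => φ (Function.update x j t) l) =
          fun t => Fl (b x, x i) l + (if l = j then t else r x l) := by
        ext t
        have hb' : b (Function.update x j t) = b x := by
          ext l
          simp only [b]
          split_ifs with h
          · rfl
          · push Not at h
            rw [Function.update_of_ne (fun hh : s l = j => h.2 (hh ▸ hj))]
        change Fl (b (Function.update x j t), Function.update x j t i) l
          + r (Function.update x j t) l = _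
        rw [hb', Function.update_of_ne hji.symm]
        congr 1
        simp only [r]
        by_cases hlj : l = j
        · subst hlj; simp [hj]
        · simp [hlj]
      rw [h2] at h1
      have h3 : HasDerivAt (fun t => Fl (b x, x i) l + (if l = j then t else r x l))
          (if l = j then 1 else 0) (x j) := by
        apply HasDerivAt.const_add
        split_ifs with h
        · exact hasDerivAt_id _
        · exact hasDerivAt_const _ _
      exact h1.unique h3
    · intro l c hc
      have hd : ∀ t ∈ Metric.ball (0:ℝ) δ,
          HasDerivAt (fun t => Fl (b x, t) l - c * t) 0 t := by
        intro t ht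
        have h3 := hasDerivAt_pi.1 ((hflow _ hx.1).2 _ ht) l
        have h4 : HasDerivAt (fun t => c * t) c t := by
          simpa using (hasDerivAt_id t).const_mul c
        have h5 := h3.sub h4
        rw [hc, sub_self] at h5
        exact h5
      have key := Metric.isOpen_ball.is_const_of_deriv_eq_zero
        (convex_ball (0:ℝ) δ).isPreconnected
        (f := fun t => Fl (b x, t) l - c * t)
        (fun t ht => (hd t ht).differentiableAt.differentiableWithinAt)
        (fun t ht => (hd t ht).deriv) hx.2 (Metric.mem_ball_self hδ)
      simp only [(hflow _ hx.1).1] at key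
      change Fl (b x, x i) l + r x l = _
      have := hbr x l
      linarith
  refine ⟨φ, hφ, ?_, ?_, hmain⟩
  · change Fl (b 0, (0 : Pt) i) + r 0 = x0
    rw [hr0, add_zero, hb0]
    exact (hflow _ (Metric.mem_ball_self hδ)).1
  · obtain ⟨h1, -, -, h4, h5⟩ := hmain.self_of_nhds
    have h00 : (0 : Pt) i = 0 := rfl
    specialize h5 h00
    have hφ0 : φ 0 = x0 := by ext l; rw [h4 h00]; simp
    rw [hφ0] at h1
    intro hdet
    obtain ⟨w, hw, hJw⟩ := Matrix.exists_mulVec_eq_zero_iff.2 hdet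
    have hrow : ∀ l, v x0 l * w i + (if s l = i then 0 else w (s l)) = 0 := by
      intro l
      have := congrFun hJw l
      rw [Matrix.mulVec, dotProduct, ← Finset.add_sum_erase _ _ (Finset.mem_univ i)] at this
      rw [h1 l] at this
      refine Eq.trans ?_ (this.trans (Pi.zero_apply l))
      congr 1
      rw [Finset.sum_congr rfl (g := fun j => if s l = j then w j else 0)]
      · rw [Finset.sum_ite_eq]
        simp
      · intro j hj
        simp at hj
        rw [h5 j hj l]
        split_ifs <;> simp
    have hwi : w i = 0 := by
      have := hrow k
      rw [if_pos hsk, add_zero] at this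
      exact (mul_eq_zero.1 this).resolve_left hk
    apply hw
    ext j
    by_cases hj : j = i
    · rw [hj, hwi]; rfl
    · have := hrow (s j)
      rw [hss, if_neg hj, hwi] at this
      simpa using this

end FlowBox

section State
open Topology

local notation "Sm" => ContDiff ℝ (⊤ : ℕ∞)

/-- admissible coordinate changes -/
structure Good (φ : Pt → Pt) : Prop where
  sm : Sm φ
  zero : φ 0 = 0
  det : (Jm φ 0).det ≠ 0
  ev : ∀ᶠ x in 𝓝 (0 : Pt), (∀ l, Jm φ x l 3 = if l = 3 then 1 else 0) ∧ φ x 3 = x 3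

lemma Good.tendsto {φ : Pt → Pt} (h : Good φ) : Tendsto φ (𝓝 0) (𝓝 0) := by
  have := h.sm.continuous.tendsto 0
  rwa [h.zero] at this

lemma Good.row {φ : Pt → Pt} (h : Good φ) :
    ∀ᶠ x in 𝓝 (0 : Pt), ∀ j, Jm φ x 3 j = if 3 = j then 1 else 0 := by
  have h1 : ∀ᶠ x in 𝓝 (0 : Pt), φ x 3 = x 3 := h.ev.mono fun x hx => hx.2
  have h2 := eventually_all.2 fun j => pd_congr_ev h1 j
  filter_upwards [h2] with x hx j
  rw [Jm, hx j, pd_proj]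

lemma Good.comp {φ ψ : Pt → Pt} (hφ : Good φ) (hψ : Good ψ) : Good (fun x => φ (ψ x)) where
  sm := hφ.sm.comp hψ.sm
  zero := by simp [hφ.zero, hψ.zero]
  det := by
    rw [Jm_comp hφ.sm hψ.sm, Matrix.det_mul, hψ.zero]
    exact mul_ne_zero hφ.det hψ.det
  ev := by
    filter_upwards [hψ.tendsto.eventually hφ.ev, hψ.ev] with x h1 h2
    refine ⟨fun l => ?_, h1.2.trans h2.2⟩
    rw [Jm_comp hφ.sm hψ.sm, Matrix.mul_apply]
    simp [h2.1, h1.1]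

lemma Jm_id (x : Pt) : Jm (fun y => y) x = 1 := by
  ext a i
  rw [Jm, pd_proj, Matrix.one_apply]

lemma Good.id : Good (fun x => x) where
  sm := contDiff_id
  zero := rfl
  det := by rw [Jm_id]; simp
  ev := by
    filter_upwards with x
    refine ⟨fun l => ?_, rfl⟩
    rw [Jm_id, Matrix.one_apply]

/-- the coefficient of `a ∧ A` -/
def tri (a : Fin 4 → ℝ) (A : Fin 4 → Fin 4 → ℝ) : ℝ :=
  a 0 * A 1 2 - a 1 * A 0 2 + a 2 * A 0 1

structure St (a : Form1) (A : Form2) : Prop where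
  sa : Sm a
  sA : Sm A
  alt : ∀ᶠ x in 𝓝 (0 : Pt), ∀ i j, A x i j = - A x j i
  a3 : ∀ᶠ x in 𝓝 (0 : Pt), a x 3 = 0
  A3 : ∀ᶠ x in 𝓝 (0 : Pt), ∀ j, A x 3 j = 0
  da3 : ∀ᶠ x in 𝓝 (0 : Pt), ∀ j, d1 a x 3 j = 0
  dA : ∀ᶠ x in 𝓝 (0 : Pt), d2 A x = w12 a A x
  frob : ∀ᶠ x in 𝓝 (0 : Pt), w12 a (d1 a) x = 0
  tri0 : tri (a 0) (A 0) ≠ 0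
  da0 : d1 a 0 ≠ 0

lemma St.pda {a : Form1} {A : Form2} (h : St a A) :
    ∀ᶠ x in 𝓝 (0 : Pt), ∀ j, pd 3 (fun y => a y j) x = 0 := by
  have h3 := eventually_all.2 fun j => pd_congr_ev (g := fun _ => 0) h.a3 j
  filter_upwards [h.da3, h3] with x h1 h2 j
  have := h1 j
  simp only [d1, h2 j, pd_const, sub_zero] at this
  exact this

lemma St.pdA {a : Form1} {A : Form2} (h : St a A) :
    ∀ᶠ x in 𝓝 (0 : Pt), ∀ i j, pd 3 (fun y => A y i j) x = 0 := by
  have h3 := eventually_all.2 fun k => eventually_all.2 fun j =>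
    pd_congr_ev (f := fun y => A y 3 j) (g := fun _ => 0) (h.A3.mono fun x hx => hx j) k
  filter_upwards [h.dA, h.a3, h.A3, h3] with x h1 h2 h4 h5 i j
  have := congrFun (congrFun (congrFun h1 3) i) j
  simp only [d2, w12, h5, pd_const, h2, h4] at this
  linarith

lemma det_pf (A : Fin 4 → Fin 4 → ℝ) (h : ∀ i j, A i j = - A j i) :
    (Matrix.of A).det = (A 0 1 * A 2 3 - A 0 2 * A 1 3 + A 0 3 * A 1 2) ^ 2 := by
  have h0 : ∀ i, A i i = 0 := fun i => by linarith [h i i]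
  simp [Matrix.det_succ_row_zero, Fin.sum_univ_succ, Fin.succAbove, h0]
  rw [h 1 0, h 2 0, h 2 1, h 3 0, h 3 1, h 3 2]
  ring

/-- `A + dx³ ∧ a` -/
def aug (a : Fin 4 → ℝ) (A : Fin 4 → Fin 4 → ℝ) : Fin 4 → Fin 4 → ℝ := fun i j =>
  A i j + ((if 3 = i then 1 else 0) * a j - (if 3 = j then 1 else 0) * a i)

lemma aug_det (a : Fin 4 → ℝ) (A : Fin 4 → Fin 4 → ℝ) (h : ∀ i j, A i j = - A j i)
    (ha : a 3 = 0) (hA : ∀ j, A 3 j = 0) : (Matrix.of (aug a A)).det = (tri a A) ^ 2 := by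
  rw [det_pf]
  · have h3 : ∀ j, A j 3 = 0 := fun j => by rw [h, hA, neg_zero]
    simp [aug, tri, h3]
    ring
  · intro i j
    simp only [aug]
    rw [h i j]; ring

lemma pull2_alt (φ : Pt → Pt) (A : Form2) (x : Pt) (h : ∀ i j, A (φ x) i j = - A (φ x) j i)
    (i j : Fin 4) : pull2 φ A x i j = - pull2 φ A x j i := by
  rw [pull2_eq, pull2_eq, Finset.sum_comm, ← Finset.sum_neg_distrib]
  refine Finset.sum_congr rfl fun a _ => ?_
  rw [← Finset.sum_neg_distrib]
  refine Finset.sum_congr rfl fun b _ => ?_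
  rw [h b a]; ring

lemma St.pull {a : Form1} {A : Form2} (h : St a A) {φ : Pt → Pt} (hφ : Good φ) :
    St (pull1 φ a) (pull2 φ A) where
  sa := pull1_smooth hφ.sm h.sa
  sA := pull2_smooth hφ.sm h.sA
  alt := by
    filter_upwards [hφ.tendsto.eventually h.alt] with x hx i j using pull2_alt φ A x hx i j
  a3 := by
    filter_upwards [hφ.tendsto.eventually h.a3, hφ.ev] with x h1 h2
    simp [pull1_eq, h2.1, h1]
  A3 := by
    filter_upwards [hφ.tendsto.eventually h.A3, hφ.ev] with x h1 h2 j
    simp [pull2_eq, h2.1, h1]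
  da3 := by
    rw [pull2_d1 hφ.sm h.sa]
    filter_upwards [hφ.tendsto.eventually h.da3, hφ.ev] with x h1 h2 j
    simp [pull2_eq, h2.1, h1]
  dA := by
    filter_upwards [hφ.tendsto.eventually h.dA, hφ.tendsto.eventually h.alt] with x h1 h2
    rw [pull3_d2 hφ.sm h.sA x h2, pull3_w12]
    ext i j k
    simp only [pull3, h1]
  frob := by
    rw [pull2_d1 hφ.sm h.sa]
    filter_upwards [hφ.tendsto.eventually h.frob] with x h1
    rw [pull3_w12]
    ext i j k
    simp [pull3, h1]
  tri0 := by
    have hrow := hφ.row.self_of_nhds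
    have hev := hφ.ev.self_of_nhds
    have halt := h.alt.self_of_nhds
    have h1 : Matrix.of (aug (pull1 φ a 0) (pull2 φ A 0))
        = (Jm φ 0).transpose * Matrix.of (aug (a 0) (A 0)) * Jm φ 0 := by
      ext i j
      simp only [Matrix.of_apply, Matrix.mul_apply, Matrix.transpose_apply, aug, pull2_eq,
        pull1_eq, hφ.zero]
      rw [← hrow i, ← hrow j]
      simp [Fin.sum_univ_four]
      ring
    have h2 := congrArg Matrix.det h1
    rw [Matrix.det_mul, Matrix.det_mul, Matrix.det_transpose,
      aug_det _ _ halt h.a3.self_of_nhds h.A3.self_of_nhds, aug_det] at h2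
    · intro h0
      rw [h0] at h2
      have h3 := h.tri0
      have h4 := hφ.det
      have : (Jm φ 0).det * tri (a 0) (A 0) ^ 2 * (Jm φ 0).det ≠ 0 := by positivity
      apply this
      rw [← h2]; norm_num
    · intro i j
      exact pull2_alt φ A 0 (by rw [hφ.zero]; exact halt) i j
    · simp [pull1_eq, hev.1, hφ.zero, h.a3.self_of_nhds]
    · intro j; simp [pull2_eq, hev.1, hφ.zero, h.A3.self_of_nhds]
  da0 := by
    rw [pull2_d1 hφ.sm h.sa]
    intro h0
    have h1 := pull2_mat φ (d1 a) 0
    rw [h0, hφ.zero] at h1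
    apply h.da0
    have hu : IsUnit (Jm φ 0).det := isUnit_iff_ne_zero.2 hφ.det
    have h2 : Matrix.of (d1 a 0) = 0 := by
      have h3 : (Jm φ 0).transpose⁻¹ * ((Jm φ 0).transpose * Matrix.of (d1 a 0) * Jm φ 0)
          * (Jm φ 0)⁻¹ = 0 := by
        rw [← h1]
        have : (Matrix.of (0 : Fin 4 → Fin 4 → ℝ)) = 0 := rfl
        rw [this]; simp
      rw [Matrix.mul_assoc (Jm φ 0).transpose, Matrix.nonsing_inv_mul_cancel_left _ _
        (by rwa [Matrix.det_transpose]), Matrix.mul_nonsing_inv_cancel_right _ _ hu] at h3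
      exact h3
    exact h2

/-- properties of the function `u` -/
structure Uok (u : Pt → ℝ) : Prop where
  sm : Sm u
  dep : ∀ p q : Pt, p 0 = q 0 → p 1 = q 1 → p 2 = q 2 → u p = u q
  zero : u 0 = 0
  grad : (pd 0 u 0) ^ 2 + (pd 1 u 0) ^ 2 > 0

def Goal (a : Form1) (A : Form2) : Prop :=
  ∃ (φ : Pt → Pt) (u : Pt → ℝ), Good φ ∧ Uok u ∧ pull1 φ a 0 2 = 1 ∧
    ∀ᶠ x in 𝓝 (0 : Pt), (∀ i, i ≠ 2 → pull1 φ a x i = 0) ∧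
      pd 3 (fun y => pull1 φ a y 2) x = 0 ∧
      ∀ i j, pull2 φ A x i j = Real.exp ((1 + u x) * x 2) * dxw 0 1 i j

lemma Goal.of_pull {a : Form1} {A : Form2} {φ : Pt → Pt} (hφ : Good φ)
    (h : Goal (pull1 φ a) (pull2 φ A)) : Goal a A := by
  obtain ⟨ψ, u, hψ, hu, h1, h2⟩ := h
  refine ⟨fun x => φ (ψ x), u, hφ.comp hψ, hu, ?_, ?_⟩
  · rw [pull1_comp hφ.sm hψ.sm]; exact h1
  · rw [pull1_comp hφ.sm hψ.sm, pull2_comp hφ.sm hψ.sm]; exact h2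

lemma pull1_id (a : Form1) : pull1 (fun x => x) a = a := by
  ext x : 1
  rw [pull1_mat, Jm_id, Matrix.vecMul_one]

lemma pull2_id (A : Form2) : pull2 (fun x => x) A = A := by
  ext x : 1
  apply Matrix.of.injective
  rw [pull2_mat, Jm_id]
  simp

end State

section Steps
open Topology

local notation "Sm" => ContDiff ℝ (⊤ : ℕ∞)

/-- set the coordinates in `S` to zero -/
def zS (S : Finset (Fin 4)) (x : Pt) : Pt := fun l => if l ∈ S then 0 else x l

lemma zS_smooth (S : Finset (Fin 4)) : Sm (zS S) := by
  refine contDiff_pi.2 fun l => ?_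
  by_cases h : l ∈ S
  · simp only [zS, if_pos h]; exact contDiff_const
  · simp only [zS, if_neg h]; exact contDiff_apply _ _ _

lemma zS_zero (S : Finset (Fin 4)) : zS S 0 = 0 := by
  ext l; simp [zS]

lemma zS_zS (S : Finset (Fin 4)) (x : Pt) : zS S (zS S x) = zS S x := by
  ext l; simp only [zS]; split_ifs <;> rfl

lemma zS_congr (S : Finset (Fin 4)) {x y : Pt} (h : ∀ j, j ∉ S → x j = y j) : zS S x = zS S y := by
  ext l; simp only [zS]; split_ifs with h1
  · rfl
  · exact h l h1

lemma zS_tendsto (S : Finset (Fin 4)) : Tendsto (zS S) (𝓝 0) (𝓝 0) := by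
  have := (zS_smooth S).continuous.tendsto 0
  rwa [zS_zero] at this

lemma zS_three (x : Pt) : zS {3} x = Function.update x 3 0 := by
  ext l
  by_cases h : l = 3
  · subst h; simp [zS]
  · simp [zS, h]

lemma flowbox0 (v : Pt → Pt) (hv : Sm v) (i k : Fin 4) (hk : v 0 k ≠ 0)
    (S : Finset (Fin 4)) (h3 : (3 : Fin 4) ∈ S) (hi : i ∉ S) (hkS : k ∉ S)
    (hS0 : ∀ x, ∀ j ∈ S, v x j = 0)
    (hS : ∀ x y : Pt, (∀ j, j ∉ S → x j = y j) → v x = v y) :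
    ∃ φ : Pt → Pt, Good φ ∧ ∀ᶠ x in 𝓝 (0 : Pt),
      (∀ l, Jm φ x l i = v (φ x) l) ∧
      (∀ j ∈ S, ∀ l, Jm φ x l j = if l = j then 1 else 0) ∧
      (∀ l c, (∀ y, v y l = c) → φ x l = c * x i
        + (if Equiv.swap i k l = i then 0 else x (Equiv.swap i k l))) ∧
      (∀ l c, (∀ y, v y l = c) → ∀ j, Jm φ x l j = c * (if i = j then 1 else 0)
        + (if Equiv.swap i k l = i then 0 else if Equiv.swap i k l = j then 1 else 0)) ∧
      (x i = 0 → ∀ l, φ x l = x (Equiv.swap i k l)) ∧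
      (x i = 0 → ∀ j, j ≠ i → ∀ l, Jm φ x l j = if Equiv.swap i k l = j then 1 else 0) := by
  obtain ⟨φ, hφ, h0, hdet, hev⟩ := flowbox v hv 0 i k hk S hi hkS hS0 hS
  have hs3 : Equiv.swap i k 3 = 3 :=
    Equiv.swap_apply_of_ne_of_ne (fun h => hi (h ▸ h3)) (fun h => hkS (h ▸ h3))
  have h3i : (3 : Fin 4) ≠ i := fun h => hi (h ▸ h3)
  refine ⟨φ, ⟨hφ, h0, hdet, ?_⟩, ?_⟩
  · filter_upwards [hev] with x hx
    refine ⟨hx.2.1 3 h3, ?_⟩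
    rw [hx.2.2.1 3 0 (fun y => hS0 y 3 h3), hs3, if_neg h3i]
    simp
  · have hrow : ∀ l, ∀ᶠ x in 𝓝 (0 : Pt), (∀ c, (∀ y, v y l = c) → ∀ j, Jm φ x l j =
        c * (if i = j then 1 else 0)
        + (if Equiv.swap i k l = i then 0 else if Equiv.swap i k l = j then 1 else 0)) := by
      intro l
      by_cases hc : ∃ c, ∀ y, v y l = c
      · obtain ⟨c, hc⟩ := hc
        have h1 : ∀ᶠ x in 𝓝 (0 : Pt), φ x l = c * x i
            + (if Equiv.swap i k l = i then 0 else x (Equiv.swap i k l)) := by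
          filter_upwards [hev] with x hx
          rw [hx.2.2.1 l c hc]; simp
        have h2 := eventually_all.2 fun j => pd_congr_ev h1 j
        filter_upwards [h2] with x hx c' hc' j
        have hcc : c' = c := by rw [← hc 0, ← hc' 0]
        rw [hcc, Jm, hx j]
        have hpi : ∀ m : Fin 4, Sm (fun y : Pt => y m) := fun m => contDiff_apply _ _ _
        split_ifs with h5 h6 h7 h8 h9
        all_goals first
          | rw [pd_add (contDiff_const.mul (hpi _)) contDiff_const]
          | rw [pd_add (contDiff_const.mul (hpi _)) (hpi _)]
        all_goals rw [pd_mul contDiff_const (hpi _), pd_const, pd_proj]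
        all_goals simp_all [pd_const, pd_proj]
      · filter_upwards with x c' hc'
        exact absurd ⟨c', hc'⟩ hc
    filter_upwards [hev, eventually_all.2 hrow] with x hx h2
    obtain ⟨e1, e2, e3, e4, e5⟩ := hx
    refine ⟨e1, e2, ?_, h2, ?_, e5⟩
    · intro l c hc; rw [e3 l c hc]; simp
    · intro h l; rw [e4 h l]; simp

lemma eq_dxw (A : Fin 4 → Fin 4 → ℝ) (h : ∀ i j, A i j = - A j i) (h3 : ∀ j, A 3 j = 0)
    (h2 : ∀ j, A 2 j = 0) (i j : Fin 4) : A i j = A 0 1 * dxw 0 1 i j := by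
  have h0 : ∀ i, A i i = 0 := fun i => by linarith [h i i]
  have h3' : ∀ j, A j 3 = 0 := fun j => by rw [h, h3, neg_zero]
  have h2' : ∀ j, A j 2 = 0 := fun j => by rw [h, h2, neg_zero]
  have h10 := h 1 0
  fin_cases i <;> fin_cases j <;> simp [dxw, h0, h3, h2, h3', h2', h10]

lemma pull2_K (φ : Pt → Pt) (A : Form2) (x : Pt)
    (h : ∀ i j, A (φ x) i j = A (φ x) 0 1 * dxw 0 1 i j) (i j : Fin 4) :
    pull2 φ A x i j = A (φ x) 0 1 * (Jm φ x 0 i * Jm φ x 1 j - Jm φ x 1 i * Jm φ x 0 j) := by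
  rw [pull2_eq]
  generalize A (φ x) 0 1 = c at h ⊢
  simp only [h]
  simp [Fin.sum_univ_four, dxw]
  ring

structure St3 (a : Form1) (A : Form2) : Prop extends St a A where
  K : ∀ᶠ x in 𝓝 (0 : Pt), ∀ i j, A x i j = A x 0 1 * dxw 0 1 i j
  a20 : a 0 2 = 1

/-- Last step: reading off `u`. -/
lemma step7 {a : Form1} {A : Form2} (h : St3 a A) (h0 : ∀ᶠ x in 𝓝 (0 : Pt), a x 0 = 0)
    (h1 : ∀ᶠ x in 𝓝 (0 : Pt), a x 1 = 0)
    (hK : ∀ᶠ x in 𝓝 (0 : Pt), x 2 = 0 → A x 0 1 = 1) : Goal a A := by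
  set f : Pt → ℝ := fun x => a x 2 with hf_def
  have hf : Sm f := Sm.coord h.sa 2
  set k : Pt → ℝ := fun x => A x 0 1 with hk_def
  have hk : Sm k := Sm.coord2 h.sA 0 1
  let La : Pt →L[ℝ] Pt := ContinuousLinearMap.pi fun l =>
    if l = 0 ∨ l = 1 then ContinuousLinearMap.proj l else 0
  let Lb : Pt →L[ℝ] Pt := ContinuousLinearMap.pi fun l =>
    if l = 2 then ContinuousLinearMap.proj l else 0
  have hLa : ∀ x l, La x l = if l = 0 ∨ l = 1 then x l else 0 := by
    intro x l; simp only [La, ContinuousLinearMap.pi_apply]; split_ifs <;> rfl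
  have hLb : ∀ x l, Lb x l = if l = 2 then x l else 0 := by
    intro x l; simp only [Lb, ContinuousLinearMap.pi_apply]; split_ifs <;> rfl
  let u : Pt → ℝ := fun x => (∫ t in (0:ℝ)..1, f (La x + t • Lb x)) - 1
  have hu : Sm u := (smooth_average f hf La Lb).sub contDiff_const
  have hline : ∀ i : Fin 4, (i = 0 ∨ i = 1) → pd i u 0 = pd i f 0 := by
    intro i hi
    have e1 := hasDerivAt_line_self hu i 0
    have e2 := (hasDerivAt_line_self hf i 0).sub_const 1
    have e3 : (fun t => u (Function.update (0 : Pt) i t)) = fun t => f (Function.update (0 : Pt) i t) - 1 := by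
      ext t
      have ea : La (Function.update (0 : Pt) i t) = Function.update (0 : Pt) i t := by
        ext l
        rw [hLa]
        split_ifs with hl
        · rfl
        · rw [Function.update_of_ne (by rintro rfl; exact hl hi)]; rfl
      have eb : Lb (Function.update (0 : Pt) i t) = 0 := by
        ext l
        rw [hLb]
        split_ifs with hl
        · rw [Function.update_of_ne (by rintro rfl; subst hl; revert hi; decide)]
        · rfl
      simp only [u, ea, eb]
      simp
    rw [e3] at e1
    exact e1.unique e2
  have hpd2 : ∀ᶠ x in 𝓝 (0 : Pt), pd 2 k x = f x * k x := by
    have z0 : ∀ᶠ x in 𝓝 (0 : Pt), A x 1 2 = 0 := by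
      filter_upwards [h.K] with x hx; rw [hx]; simp [dxw]
    have z1 : ∀ᶠ x in 𝓝 (0 : Pt), A x 0 2 = 0 := by
      filter_upwards [h.K] with x hx; rw [hx]; simp [dxw]
    filter_upwards [h.dA, h0, h1, pd_congr_ev (g := fun _ => 0) z0 0,
      pd_congr_ev (g := fun _ => 0) z1 1] with x e1 e2 e3 e4 e5
    have := congrFun (congrFun (congrFun e1 0) 1) 2
    simp only [d2, w12, e4, e5, pd_const, e2, e3] at this
    simp only [hk_def, hf_def]
    linarith
  have hk3 : ∀ᶠ x in 𝓝 (0 : Pt), k x = k (Function.update x 3 0) :=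
    const_of_pd_zero hk 3 (h.pdA.mono fun x hx => hx 0 1)
  obtain ⟨ε, hε, hb⟩ := Metric.eventually_nhds_iff_ball.1 (hpd2.and hK)
  have hexp : ∀ᶠ x in 𝓝 (0 : Pt), k x = Real.exp ((1 + u x) * x 2) := by
    filter_upwards [hk3, Metric.ball_mem_nhds _ hε] with x e1 hx
    let y : ℝ → Pt := fun t => La x + t • Lb x
    have hyl : ∀ t l, y t l = (if l = 0 ∨ l = 1 then x l else 0) + t * (if l = 2 then x l else 0) := by
      intro t l
      simp only [y, Pi.add_apply, Pi.smul_apply, hLa, hLb, smul_eq_mul]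
    have hy1 : y 1 = Function.update x 3 0 := by
      ext l
      rw [hyl]
      fin_cases l <;> simp [Function.update]
    have hyb : ∀ t ∈ Set.Icc (0:ℝ) 1, y t ∈ Metric.ball (0 : Pt) ε := by
      intro t ht
      rw [Metric.mem_ball, dist_pi_lt_iff hε] at *
      intro l
      have hxl := hx l
      rw [Pi.zero_apply, dist_zero_right] at *
      rw [hyl]
      by_cases h2 : l = 2
      · subst h2
        simp only [if_true]
        rw [if_neg (by decide), zero_add, norm_mul]
        refine lt_of_le_of_lt ?_ hxl
        rw [Real.norm_eq_abs t, abs_of_nonneg ht.1]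
        nlinarith [norm_nonneg (x 2), ht.2]
      · rw [if_neg h2, mul_zero, add_zero]
        split_ifs
        · exact hxl
        · simpa using hε
    have hyd : ∀ t, HasDerivAt y (Lb x) t := by
      intro t
      have := ((hasDerivAt_id t).smul_const (Lb x)).const_add (La x)
      rw [one_smul] at this
      exact this
    have hkd : ∀ t, HasDerivAt (fun t => k (y t)) (x 2 * pd 2 k (y t)) t := by
      intro t
      have := (Sm.diffAt hk (y t)).hasFDerivAt.comp_hasDerivAt t (hyd t)
      rw [fderiv_eq_sum] at this
      have e : ∑ j, Lb x j * pd j k (y t) = x 2 * pd 2 k (y t) := by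
        simp [hLb]
      rw [e] at this
      exact this
    have hcont : Continuous (fun s => f (y s)) :=
      hf.continuous.comp (by simp only [y]; fun_prop)
    have hFd : ∀ t, HasDerivAt (fun t => ∫ s in (0:ℝ)..t, f (y s)) (f (y t)) t := by
      intro t
      exact intervalIntegral.integral_hasDerivAt_right (hcont.intervalIntegrable _ _)
        (hcont.stronglyMeasurableAtFilter _ _) hcont.continuousAt
    have hhd : ∀ t ∈ Set.Icc (0:ℝ) 1, HasDerivAt
        (fun t => k (y t) * Real.exp (-(x 2 * ∫ s in (0:ℝ)..t, f (y s)))) 0 t := by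
      intro t ht
      have e2 := (hkd t).mul (((hFd t).const_mul (x 2)).neg.exp)
      refine e2.congr_deriv ?_
      rw [(hb _ (hyb t ht)).1]
      simp only [Pi.neg_apply]
      ring
    have key := constant_of_has_deriv_right_zero (a := (0:ℝ)) (b := 1)
      (fun t ht => (hhd t ht).continuousAt.continuousWithinAt)
      (fun t ht => (hhd t ⟨ht.1, ht.2.le⟩).hasDerivWithinAt) 1 ⟨zero_le_one, le_rfl⟩
    have hy0 : k (y 0) = 1 := by
      apply (hb _ (hyb 0 ⟨le_rfl, zero_le_one⟩)).2
      rw [hyl]; simp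
    simp only [hy0, intervalIntegral.integral_same, mul_zero, neg_zero, Real.exp_zero] at key
    rw [hy1, ← e1, Real.exp_neg] at key
    have h5 : k x = Real.exp (x 2 * ∫ s in (0:ℝ)..1, f (y s)) := by
      have := Real.exp_pos (x 2 * ∫ s in (0:ℝ)..1, f (y s))
      field_simp at key
      linarith
    rw [h5]
    congr 1
    simp only [u, y]
    ring
  refine ⟨fun x => x, u, Good.id, ⟨hu, ?_, ?_, ?_⟩, ?_, ?_⟩
  · intro p q hp0 hp1 hp2
    have ea : La p = La q := by
      ext l
      rw [hLa, hLa]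
      split_ifs with hl
      · rcases hl with rfl | rfl <;> assumption
      · rfl
    have eb : Lb p = Lb q := by
      ext l
      rw [hLb, hLb]
      split_ifs with hl
      · rw [hl, hp2]
      · rfl
    simp only [u, ea, eb]
  · have : f 0 = 1 := h.a20
    simp [u, this]
  · rw [hline 0 (Or.inl rfl), hline 1 (Or.inr rfl)]
    by_contra hcon
    have hz0 : pd 0 f 0 = 0 := by nlinarith [sq_nonneg (pd 0 f 0), sq_nonneg (pd 1 f 0)]
    have hz1 : pd 1 f 0 = 0 := by nlinarith [sq_nonneg (pd 0 f 0), sq_nonneg (pd 1 f 0)]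
    have hz3 : pd 3 f 0 = 0 := h.pda.self_of_nhds 2
    apply h.da0
    have p0 : ∀ i, pd i (fun y => a y 0) 0 = 0 := fun i => by
      rw [pd_congr (g := fun _ => 0) h0 i, pd_const]
    have p1 : ∀ i, pd i (fun y => a y 1) 0 = 0 := fun i => by
      rw [pd_congr (g := fun _ => 0) h1 i, pd_const]
    have p3 : ∀ i, pd i (fun y => a y 3) 0 = 0 := fun i => by
      rw [pd_congr (g := fun _ => 0) h.a3 i, pd_const]
    simp only [hf_def] at hz0 hz1 hz3
    ext i j
    fin_cases i <;> fin_cases j <;> simp [d1, p0, p1, p3, hz0, hz1, hz3]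
  · rw [pull1_id]; exact h.a20
  · rw [pull1_id, pull2_id]
    filter_upwards [h0, h1, h.a3, h.pda, h.K, hexp] with x e0 e1 e3 e4 e5 e6
    refine ⟨?_, e4 2, ?_⟩
    · intro i hi
      fin_cases i
      · exact e0
      · exact e1
      · exact absurd rfl hi
      · exact e3
    · intro i j
      rw [e5 i j]
      congr 1

end Steps

section Steps2
open Topology

local notation "Sm" => ContDiff ℝ (⊤ : ℕ∞)

lemma zS_three_const {f : Pt → ℝ} (hf : Sm f) (h : ∀ᶠ x in 𝓝 (0 : Pt), pd 3 f x = 0) :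
    ∀ᶠ x in 𝓝 (0 : Pt), f x = f (zS {3} x) := by
  filter_upwards [const_of_pd_zero hf 3 h] with x hx
  rw [zS_three]; exact hx

lemma St3.A01 {a : Form1} {A : Form2} (h : St3 a A) : A 0 0 1 ≠ 0 := by
  intro h0
  apply h.tri0
  have := h.K.self_of_nhds
  rw [tri, this 1 2, this 0 2, this 0 1, h0]; simp

lemma step6 {a : Form1} {A : Form2} (h : St3 a A) (h0 : ∀ᶠ x in 𝓝 (0 : Pt), a x 0 = 0)
    (h1 : ∀ᶠ x in 𝓝 (0 : Pt), a x 1 = 0) : Goal a A := by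
  have hk : Sm (fun x => A x 0 1) := Sm.coord2 h.sA 0 1
  obtain ⟨q, hq, hqe⟩ := ext_div (f := fun _ => (1:ℝ)) contDiff_const hk h.A01
  let v : Pt → Pt := fun x l => if l = 0 then q (zS {2, 3} x) else 0
  have hv : Sm v := by
    refine contDiff_pi.2 fun l => ?_
    by_cases hl : l = 0
    · simp only [v, if_pos hl]; exact hq.comp (zS_smooth _)
    · simp only [v, if_neg hl]; exact contDiff_const
  have hq0 : q 0 ≠ 0 := by
    intro h5
    have := hqe.self_of_nhds
    rw [h5] at this; simp at this
  obtain ⟨φ, hφ, hev⟩ := flowbox0 v hv 0 0 (by simpa [v, zS_zero] using hq0) {2, 3} (by decide)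
    (by decide) (by decide) (by
      intro x j hj
      have : j ≠ 0 := by rintro rfl; revert hj; decide
      simp [v, this])
    (by
      intro x y hxy
      ext l
      simp only [v]
      rw [zS_congr _ hxy])
  have hd : ∀ l : Fin 4, l ≠ 0 → ∀ y, v y l = 0 := fun l hl y => by simp [v, hl]
  have ht := hφ.tendsto
  have hSt := h.toSt.pull hφ
  have hK := ht.eventually h.K
  have h0' := ht.eventually h0
  have h1' := ht.eventually h1
  have hrow : ∀ᶠ x in 𝓝 (0 : Pt), ∀ l : Fin 4, l ≠ 0 → ∀ j, Jm φ x l j = if l = j then 1 else 0 := by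
    filter_upwards [hev] with x hx l hl j
    rw [hx.2.2.2.1 l 0 (hd l hl) j]
    simp [hl]
  have hK' : ∀ᶠ x in 𝓝 (0 : Pt), ∀ i j, pull2 φ A x i j = (A (φ x) 0 1 * Jm φ x 0 0) * dxw 0 1 i j := by
    filter_upwards [hK, hrow, hev] with x hx hr he i j
    rw [pull2_K φ A x hx]
    have e2 := he.2.1 2 (by decide)
    have e3 := he.2.1 3 (by decide)
    rw [hr 1 (by decide), hr 1 (by decide)]
    fin_cases i <;> fin_cases j <;> simp [dxw, e2, e3]
  have hpa : ∀ᶠ x in 𝓝 (0 : Pt), ∀ j, pull1 φ a x j = a (φ x) 2 * if 2 = j then 1 else 0 := by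
    filter_upwards [hrow, h0', h1', ht.eventually h.a3] with x hr e0 e1 e3 j
    rw [pull1_eq, Fin.sum_univ_four, e0, e1, e3, hr 2 (by decide)]
    simp
  refine Goal.of_pull hφ (step7 ⟨hSt, ?_, ?_⟩ ?_ ?_ ?_)
  · filter_upwards [hK'] with x hx i j
    rw [hx, hx 0 1]; simp [dxw]
  · rw [hpa.self_of_nhds, hφ.zero]; simp [h.a20]
  · filter_upwards [hpa] with x hx; rw [hx]; simp
  · filter_upwards [hpa] with x hx; rw [hx]; simp
  · have hc := zS_three_const hk (h.pdA.mono fun x hx => hx 0 1)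
    filter_upwards [hK', hev, ht.eventually hc, ht.eventually ((zS_tendsto {2,3}).eventually hqe)]
      with x hx he e1 e2 hx2
    have e3 : φ x 2 = 0 := by
      rw [he.2.2.1 2 0 (hd 2 (by decide))]; simp [hx2]
    rw [hx, he.1 0, e1]
    have e4 : zS {3} (φ x) = zS {2, 3} (φ x) := by
      ext l; fin_cases l <;> simp [zS, e3]
    rw [e4]
    simp [v, dxw]
    linarith

lemma step45 {a : Form1} {A : Form2} (h : St3 a A) (m n : Fin 4) (hmn : (m = 0 ∧ n = 1) ∨ (m = 1 ∧ n = 0)) :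
    ∃ φ, Good φ ∧ St3 (pull1 φ a) (pull2 φ A) ∧ (∀ᶠ x in 𝓝 (0 : Pt), pull1 φ a x m = 0) ∧
      ((∀ᶠ x in 𝓝 (0 : Pt), a x n = 0) → ∀ᶠ x in 𝓝 (0 : Pt), x m = 0 → pull1 φ a x n = 0) := by
  have ha2 : Sm (fun x => a x 2) := Sm.coord h.sa 2
  have ham : Sm (fun x => a x m) := Sm.coord h.sa m
  obtain ⟨q, hq, hqe⟩ := ext_div (f := fun x => - a x m) ham.neg ha2 (x0 := 0) (by rw [h.a20]; simp)
  have hqe3 := pd_congr_ev hqe 3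
  have ha2e : ∀ᶠ x in 𝓝 (0 : Pt), a x 2 ≠ 0 :=
    ha2.continuous.continuousAt.eventually_ne (by rw [h.a20]; simp)
  have hq3 : ∀ᶠ x in 𝓝 (0 : Pt), pd 3 q x = 0 := by
    filter_upwards [hqe3, h.pda, ha2e] with x e1 e2 e3
    rw [pd_mul hq ha2, pd_neg, e2 2, e2 m] at e1
    have : pd 3 q x * a x 2 = 0 := by linarith
    exact (mul_eq_zero.1 this).resolve_right e3
  have hqc := zS_three_const hq hq3
  have hm2 : m ≠ 2 := by rcases hmn with ⟨rfl, _⟩ | ⟨rfl, _⟩ <;> decide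
  have hm3 : m ≠ 3 := by rcases hmn with ⟨rfl, _⟩ | ⟨rfl, _⟩ <;> decide
  let v : Pt → Pt := fun x l => if l = m then 1 else if l = 2 then q (zS {3} x) else 0
  have hv : Sm v := by
    refine contDiff_pi.2 fun l => ?_
    by_cases hl : l = m
    · simp only [v, if_pos hl]; exact contDiff_const
    by_cases hl2 : l = 2
    · simp only [v, if_neg hl, if_pos hl2]; exact hq.comp (zS_smooth _)
    · simp only [v, if_neg hl, if_neg hl2]; exact contDiff_const
  obtain ⟨φ, hφ, hev⟩ := flowbox0 v hv m m (by simp [v]) {3} (by decide)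
    (by simpa using hm3) (by simpa using hm3) (by
      intro x j hj
      obtain rfl := Finset.mem_singleton.1 hj
      simp [v, hm3.symm])
    (by
      intro x y hxy
      ext l
      simp only [v]
      rw [zS_congr _ hxy])
  have hd : ∀ l : Fin 4, l ≠ 2 → ∀ y, v y l = if l = m then 1 else 0 := fun l hl y => by simp [v, hl]
  have ht := hφ.tendsto
  have hSt := h.toSt.pull hφ
  have hrow : ∀ᶠ x in 𝓝 (0 : Pt), ∀ l : Fin 4, l ≠ 2 → ∀ j, Jm φ x l j = if l = j then 1 else 0 := by
    filter_upwards [hev] with x hx l hl j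
    rw [hx.2.2.2.1 l _ (hd l hl) j]
    by_cases hlm : l = m
    · subst hlm; simp
    · simp [hlm]
  have hn2 : n ≠ 2 := by rcases hmn with ⟨_, rfl⟩ | ⟨_, rfl⟩ <;> decide
  have hnm : n ≠ m := by rcases hmn with ⟨rfl, rfl⟩ | ⟨rfl, rfl⟩ <;> decide
  have hpj : ∀ᶠ x in 𝓝 (0 : Pt), ∀ j, pull1 φ a x j = (if j = 2 then 0 else a (φ x) j) + a (φ x) 2 * Jm φ x 2 j := by
    filter_upwards [hrow] with x hr j
    rw [pull1_eq, Fin.sum_univ_four, hr 0 (by decide), hr 1 (by decide), hr 3 (by decide)]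
    fin_cases j <;> simp <;> ring
  have hs2 : ∀ᶠ x in 𝓝 (0 : Pt), x m = 0 → ∀ j, j ≠ m → Jm φ x 2 j = if 2 = j then 1 else 0 := by
    filter_upwards [hev] with x hx hxm j hj
    rw [hx.2.2.2.2.2 hxm j hj 2]
    simp
  refine ⟨φ, hφ, ⟨hSt, ?_, ?_⟩, ?_, ?_⟩
  · filter_upwards [ht.eventually h.K, hrow] with x hx hr i j
    rw [pull2_K φ A x hx, pull2_K φ A x hx, hr 0 (by decide), hr 1 (by decide), hr 0 (by decide), hr 1 (by decide),
      hr 0 (by decide), hr 1 (by decide), hr 0 (by decide), hr 1 (by decide)]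
    fin_cases i <;> fin_cases j <;> simp [dxw]
  · rw [hpj.self_of_nhds, hφ.zero, hs2.self_of_nhds rfl 2 hm2.symm, h.a20]; simp
  · filter_upwards [hpj, hev, ht.eventually hqe, ht.eventually hqc] with x h1 h2 h3 h4
    rw [h1, h2.1]
    simp only [v, if_neg hm2, if_neg hm2.symm, if_true]
    rw [← h4]
    linarith
  · intro hn
    filter_upwards [hpj, hs2, ht.eventually hn] with x h1 h2 h3 hxm
    rw [h1, h2 hxm n hnm, h3]
    simp [hn2, hn2.symm]

lemma step5 {a : Form1} {A : Form2} (h : St3 a A) (h0 : ∀ᶠ x in 𝓝 (0 : Pt), a x 0 = 0) : Goal a A := by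
  obtain ⟨φ, hφ, hS, hm, hn⟩ := step45 h 1 0 (Or.inr ⟨rfl, rfl⟩)
  refine Goal.of_pull hφ (step6 hS ?_ hm)
  have hn := hn h0
  generalize pull1 φ a = b at *
  generalize pull2 φ A = B at *
  have hb2 : Sm (fun x => b x 2) := Sm.coord hS.sa 2
  have hb0 : Sm (fun x => b x 0) := Sm.coord hS.sa 0
  obtain ⟨q, hq, hqe⟩ := ext_div (f := fun x => b x 0) hb0 hb2 (x0 := 0) (by rw [hS.a20]; simp)
  have hb2e : ∀ᶠ x in 𝓝 (0 : Pt), b x 2 ≠ 0 :=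
    hb2.continuous.continuousAt.eventually_ne (by rw [hS.a20]; simp)
  have hq1 : ∀ᶠ x in 𝓝 (0 : Pt), pd 1 q x = 0 := by
    filter_upwards [hqe, pd_congr_ev hqe 1, hb2e, hm, pd_congr_ev (g := fun _ => 0) hm 0, pd_congr_ev (g := fun _ => 0) hm 2, hS.frob]
      with x e1 e2 e3 e4 e5 e6 e7
    have e8 := congrFun (congrFun (congrFun e7 0) 1) 2
    simp only [w12, d1, e4, e5, e6, pd_const, Pi.zero_apply] at e8
    rw [pd_mul hq hb2] at e2
    have : pd 1 q x * b x 2 * b x 2 = 0 := by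
      rw [← e1] at e8
      rw [← e2] at e8
      linarith
    simpa [e3] using this
  have hqc := const_of_pd_zero hq 1 hq1
  have hu : Tendsto (fun x : Pt => Function.update x 1 0) (𝓝 0) (𝓝 0) := by
    have : Continuous (fun x : Pt => Function.update x 1 (0:ℝ)) := continuous_id.update 1 continuous_const
    have h2 := this.tendsto 0
    simpa using h2
  filter_upwards [hqc, hqe, hu.eventually hqe, hu.eventually hn, hu.eventually hb2e] with x e1 e2 e3 e4 e5
  have e6 := e4 (by simp)
  rw [e6] at e3
  have : q (Function.update x 1 0) = 0 := (mul_eq_zero.1 e3).resolve_right e5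
  rw [← e2, e1, this, zero_mul]

lemma step4 {a : Form1} {A : Form2} (h : St3 a A) : Goal a A := by
  obtain ⟨φ, hφ, hS, hm, -⟩ := step45 h 0 1 (Or.inl ⟨rfl, rfl⟩)
  exact Goal.of_pull hφ (step5 hS hm)

lemma step3 {a : Form1} {A : Form2} (h : St a A) : Goal a A := by
  let c : ℝ := 1 / tri (a 0) (A 0)
  have hc : c ≠ 0 := one_div_ne_zero h.tri0
  let v : Pt → Pt := fun x l => c * (if l = 0 then A (zS {3} x) 1 2 else if l = 1 then - A (zS {3} x) 0 2
    else if l = 2 then A (zS {3} x) 0 1 else 0)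
  have hA : ∀ i j, Sm (fun x => A (zS {3} x) i j) := fun i j => (Sm.coord2 h.sA i j).comp (zS_smooth {3})
  have hv : Sm v := by
    refine contDiff_pi.2 fun l => contDiff_const.mul ?_
    fin_cases l
    · exact hA 1 2
    · exact (hA 0 2).neg
    · exact hA 0 1
    · exact contDiff_const
  obtain ⟨k, hk3, hk⟩ : ∃ k : Fin 4, k ≠ 3 ∧ v 0 k ≠ 0 := by
    by_contra hcon
    push Not at hcon
    apply h.tri0
    have e0 := hcon 0 (by decide)
    have e1 := hcon 1 (by decide)
    have e2 := hcon 2 (by decide)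
    simp [v, hc, zS_zero] at e0 e1 e2
    simp [tri, e0, e1, e2]
  obtain ⟨φ, hφ, hev⟩ := flowbox0 v hv 2 k hk {3} (by decide)
    (by decide) (by simpa using hk3) (by
      intro x j hj
      obtain rfl := Finset.mem_singleton.1 hj
      simp [v])
    (by
      intro x y hxy
      ext l
      simp only [v]
      rw [zS_congr _ hxy])
  have ht := hφ.tendsto
  have hSt := h.pull hφ
  have hAc : ∀ᶠ x in 𝓝 (0 : Pt), ∀ i j, A x i j = A (zS {3} x) i j :=
    eventually_all.2 fun i => eventually_all.2 fun j =>
      zS_three_const (Sm.coord2 h.sA i j) (h.pdA.mono fun x hx => hx i j)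
  refine Goal.of_pull hφ (step4 ⟨hSt, ?_, ?_⟩)
  · filter_upwards [hSt.alt, hSt.A3, hev, ht.eventually hAc, ht.eventually h.alt, ht.eventually h.A3]
      with x e1 e2 e3 e4 e5 e6 i j
    refine eq_dxw _ e1 e2 (fun j => ?_) i j
    rw [pull2_eq]
    simp only [e3.1, v, ← e4]
    have z : ∀ i, A (φ x) i i = 0 := fun i => by linarith [e5 i i]
    have e6' : ∀ j, A (φ x) j 3 = 0 := fun j => by rw [e5, e6, neg_zero]
    simp [Fin.sum_univ_four, e6, e6', z]
    rw [e5 1 0, e5 2 0, e5 2 1]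
    ring
  · have e := hev.self_of_nhds.1
    rw [pull1_eq, Fin.sum_univ_four, e, e, e, e, hφ.zero]
    simp only [v, zS_zero]
    have : c * tri (a 0) (A 0) = 1 := by simp only [c]; field_simp [h.tri0]
    rw [tri] at this
    simp
    linarith

end Steps2

section Steps3
open Topology

local notation "Sm" => ContDiff ℝ (⊤ : ℕ∞)

/-- the normal form -/
def NF (u : Pt → ℝ) (B : Form2) : Prop := ∀ᶠ x in 𝓝 (0 : Pt), ∀ i j, B x i j =
  Real.exp ((1 + u x) * x 2) * dxw 0 1 i j + dxw 2 3 i j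

lemma pull2_aug (φ : Pt → Pt) (a : Form1) (A B Ω : Form2) (x : Pt) (hx : φ x 3 = x 3)
    (hrow : ∀ j, Jm φ x 3 j = if 3 = j then 1 else 0)
    (h : ∀ i j, Ω (φ x) i j = A (φ x) i j + ((if 3 = i then 1 else 0) * a (φ x) j
      - (if 3 = j then 1 else 0) * a (φ x) i) + φ x 3 * B (φ x) i j) (i j : Fin 4) :
    pull2 φ Ω x i j = pull2 φ A x i j + ((if 3 = i then 1 else 0) * pull1 φ a x j
      - (if 3 = j then 1 else 0) * pull1 φ a x i) + x 3 * pull2 φ B x i j := by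
  simp only [pull2_eq, pull1_eq]
  rw [← hrow i, ← hrow j]
  simp only [h, hx]
  simp [Fin.sum_univ_four]
  ring

lemma step8 {a : Form1} {A Ω : Form2} (ha : Sm a) (hG : Goal a A)
    (hΩ : ∀ᶠ x in 𝓝 (0 : Pt), ∀ i j, Ω x i j = A x i j + ((if 3 = i then 1 else 0) * a x j
      - (if 3 = j then 1 else 0) * a x i) + x 3 * d1 a x i j) :
    ∃ Φ u, Sm Φ ∧ Φ 0 = 0 ∧ Uok u ∧ NF u (pull2 Φ Ω) := by
  obtain ⟨φ, u, hφ, hu, hf0, hev⟩ := hG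
  have hb : Sm (pull1 φ a) := pull1_smooth hφ.sm ha
  have h1 : ∀ᶠ x in 𝓝 (0 : Pt), ∀ i j, pull2 φ Ω x i j = pull2 φ A x i j +
      ((if 3 = i then 1 else 0) * pull1 φ a x j
      - (if 3 = j then 1 else 0) * pull1 φ a x i) + x 3 * d1 (pull1 φ a) x i j := by
    filter_upwards [hφ.tendsto.eventually hΩ, hφ.row, hφ.ev] with x e1 e2 e3
    rw [pull2_d1 hφ.sm ha]
    exact pull2_aug φ a A (d1 a) Ω x e3.2 e2 e1
  generalize hbdef : pull1 φ a = b at *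
  set f : Pt → ℝ := fun x => b x 2 with hfdef
  have hf : Sm f := Sm.coord hb 2
  have hz : ∀ᶠ x in 𝓝 (0 : Pt), ∀ i, i ≠ 2 → ∀ k, pd k (fun y => b y i) x = 0 := by
    refine eventually_all.2 fun i => ?_
    by_cases hi : i = 2
    · filter_upwards with x h; exact absurd hi h
    · have : ∀ᶠ x in 𝓝 (0 : Pt), b x i = 0 := hev.mono fun x hx => hx.1 i hi
      filter_upwards [eventually_all.2 fun k => pd_congr_ev (g := fun _ => 0) this k] with x hx _ k
      rw [hx k, pd_const]
  have h2 : ∀ᶠ x in 𝓝 (0 : Pt), ∀ i j, pull2 φ Ω x i j =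
      Real.exp ((1 + u x) * x 2) * dxw 0 1 i j +
      ((if 3 = i then 1 else 0) * (if 2 = j then f x else 0)
      - (if 3 = j then 1 else 0) * (if 2 = i then f x else 0)) +
      x 3 * ((if 2 = j then pd i f x else 0) - (if 2 = i then pd j f x else 0)) := by
    filter_upwards [h1, hev, hz] with x e1 e2 e3 i j
    have k1 : ∀ i, b x i = if 2 = i then f x else 0 := by
      intro i
      split_ifs with h
      · rw [← h]
      · exact e2.1 i (Ne.symm h)
    have k2 : ∀ k i, pd k (fun y => b y i) x = if 2 = i then pd k f x else 0 := by
      intro k i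
      split_ifs with h
      · rw [← h]
      · exact e3 i (Ne.symm h) k
    rw [e1, e2.2.2 i j, k1 i, k1 j]
    simp only [d1, k2]
  have hf0' : f 0 ≠ 0 := by rw [hfdef]; simp [hf0]
  obtain ⟨g, hg, hge⟩ := ext_div (f := fun _ => (1:ℝ)) contDiff_const hf hf0'
  let s : Pt → ℝ := fun x => - (x 3 * g x)
  have hp3 : Sm (fun x : Pt => x 3) := contDiff_apply _ _ _
  have hs : Sm s := (hp3.mul hg).neg
  let σ : Pt → Pt := fun x => Function.update x 3 (s x)
  have hσ : Sm σ := by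
    refine contDiff_pi.2 fun l => ?_
    by_cases hl : l = 3
    · subst hl; simpa [σ] using hs
    · simp only [σ, Function.update_of_ne hl]; exact contDiff_apply _ _ _
  have hσ0 : σ 0 = 0 := by
    ext l; by_cases hl : l = 3
    · subst hl; simp [σ, s]
    · simp [σ, hl]
  have hσt : Tendsto σ (𝓝 0) (𝓝 0) := by
    have := hσ.continuous.tendsto 0
    rwa [hσ0] at this
  have hfc := const_of_pd_zero hf 3 (hev.mono fun x hx => hx.2.1)
  have hfσ : ∀ᶠ x in 𝓝 (0 : Pt), f (σ x) = f x := by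
    filter_upwards [hfc, hσt.eventually hfc] with x e1 e2
    rw [e1, e2]; simp [σ]
  have hfσd : ∀ᶠ x in 𝓝 (0 : Pt), ∀ i, ∑ l, pd l f (σ x) * Jm σ x l i = pd i f x := by
    filter_upwards [eventually_all.2 fun i => pd_congr_ev hfσ i] with x hx i
    rw [← hx i, pd_comp hf hσ]; rfl
  have hJ : ∀ x l j, l ≠ 3 → Jm σ x l j = if l = j then 1 else 0 := by
    intro x l j hl
    have : (fun y => σ y l) = fun y : Pt => y l := by ext y; simp [σ, hl]
    rw [Jm, this, pd_proj]
  have hJ3 : ∀ x j, Jm σ x 3 j = - ((if 3 = j then 1 else 0) * g x + x 3 * pd j g x) := by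
    intro x j
    have : (fun y => σ y 3) = fun y : Pt => - (y 3 * g y) := by ext y; simp [σ, s]
    rw [Jm, this, pd_neg, pd_mul hp3 hg, pd_proj]
  refine ⟨fun x => φ (σ x), u, hφ.sm.comp hσ, by simp [hσ0, hφ.zero], hu, ?_⟩
  rw [pull2_comp hφ.sm hσ]
  filter_upwards [hσt.eventually h2, hfσ, hfσd, hge, eventually_all.2 fun i => pd_congr_ev hge i]
    with x e1 e2 e3 e4 e5 i j
  have huσ : u (σ x) = u x := hu.dep _ _ (by simp [σ]) (by simp [σ]) (by simp [σ])
  have hσ2 : σ x 2 = x 2 := by simp [σ]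
  have hσ3 : σ x 3 = - (x 3 * g x) := by simp [σ, s]
  have key : ∀ i, f x * Jm σ x 3 i - x 3 * g x * pd i f x = - (if 3 = i then 1 else 0) := by
    intro i
    have := e5 i
    rw [pd_mul hg hf, pd_const] at this
    rw [hJ3]
    linear_combination (-(x 3)) * this - (if 3 = i then 1 else 0) * e4
  have main : pull2 σ (pull2 φ Ω) x i j = Real.exp ((1 + u x) * x 2) * dxw 0 1 i j
      + ((f x * Jm σ x 3 i - x 3 * g x * pd i f x) * (if 2 = j then 1 else 0)
      - (f x * Jm σ x 3 j - x 3 * g x * pd j f x) * (if 2 = i then 1 else 0)) := by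
    rw [pull2_eq, ← e3 i, ← e3 j]
    simp only [e1, huσ, hσ2, hσ3, e2]
    have q0 := fun j => hJ x 0 j (by decide)
    have q1 := fun j => hJ x 1 j (by decide)
    have q2 := fun j => hJ x 2 j (by decide)
    have r1 : dxw 0 1 i j = Jm σ x 0 i * Jm σ x 1 j - Jm σ x 1 i * Jm σ x 0 j := by
      rw [q0, q1, q0, q1]
      fin_cases i <;> fin_cases j <;> simp [dxw]
    rw [r1, ← q2 i, ← q2 j]
    simp [Fin.sum_univ_four, dxw]
    ring
  rw [main, key, key]
  fin_cases i <;> fin_cases j <;> simp [dxw]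

end Steps3

section Steps4
open Topology

local notation "Sm" => ContDiff ℝ (⊤ : ℕ∞)

/-- the Pfaffian -/
def pf (B : Fin 4 → Fin 4 → ℝ) : ℝ := B 0 1 * B 2 3 - B 0 2 * B 1 3 + B 0 3 * B 1 2

lemma d2_d1 {a : Form1} (ha : Sm a) (x : Pt) (i j k : Fin 4) : d2 (d1 a) x i j k = 0 := by
  have hs : ∀ i j, Sm (pd i (fun y => a y j)) := fun i j => pd_smooth (Sm.coord ha j) i
  simp only [d2, d1]
  rw [pd_sub (hs _ _) (hs _ _), pd_sub (hs _ _) (hs _ _), pd_sub (hs _ _) (hs _ _),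
    pd_comm (Sm.coord ha k) i j, pd_comm (Sm.coord ha j) i k, pd_comm (Sm.coord ha i) j k]
  ring

/-- `d(a ∧ B) = da ∧ B - a ∧ dB` together with `d d B = 0`. -/
lemma dd_wedge {a : Form1} {B : Form2} (ha : Sm a) (hB : Sm B)
    (h : ∀ᶠ x in 𝓝 (0 : Pt), d2 B x = w12 a B x) :
    ∀ᶠ x in 𝓝 (0 : Pt), w22 (d1 a) B x 0 1 2 3 = 0 := by
  have hc : ∀ i j k l, ∀ᶠ x in 𝓝 (0 : Pt), pd l (fun y => d2 B y i j k) x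
      = pd l (fun y => w12 a B y i j k) x := fun i j k l =>
    pd_congr_ev (h.mono fun x hx => by rw [hx]) l
  have hs : ∀ i j k, Sm (pd i (fun y => B y j k)) := fun i j k => pd_smooth (Sm.coord2 hB j k) i
  have e1 : ∀ i j k l x, pd l (fun y => d2 B y i j k) x = pd l (pd i (fun y => B y j k)) x
      - pd l (pd j (fun y => B y i k)) x + pd l (pd k (fun y => B y i j)) x := by
    intro i j k l x
    simp only [d2]
    rw [pd_add ((hs _ _ _).sub (hs _ _ _)) (hs _ _ _), pd_sub (hs _ _ _) (hs _ _ _)]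
  have hm : ∀ i j k, Sm (fun y => a y i * B y j k) := fun i j k =>
    (Sm.coord ha i).mul (Sm.coord2 hB j k)
  have e2 : ∀ i j k l x, pd l (fun y => w12 a B y i j k) x =
      (pd l (fun y => a y i) x * B x j k + a x i * pd l (fun y => B y j k) x)
      - (pd l (fun y => a y j) x * B x i k + a x j * pd l (fun y => B y i k) x)
      + (pd l (fun y => a y k) x * B x i j + a x k * pd l (fun y => B y i j) x) := by
    intro i j k l x
    simp only [w12]
    rw [pd_add ((hm _ _ _).sub (hm _ _ _)) (hm _ _ _), pd_sub (hm _ _ _) (hm _ _ _),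
      pd_mul (Sm.coord ha i) (Sm.coord2 hB j k), pd_mul (Sm.coord ha j) (Sm.coord2 hB i k),
      pd_mul (Sm.coord ha k) (Sm.coord2 hB i j)]
  filter_upwards [h, hc 1 2 3 0, hc 0 2 3 1, hc 0 1 3 2, hc 0 1 2 3] with x h0 h1 h2 h3 h4
  have g : ∀ i j k, d2 B x i j k = w12 a B x i j k := fun i j k => by rw [h0]
  have g1 := g 1 2 3
  have g2 := g 0 2 3
  have g3 := g 0 1 3
  have g4 := g 0 1 2
  rw [e1, e2] at h1 h2 h3 h4
  simp only [d2, w12] at g1 g2 g3 g4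
  have c := fun i j k l => pd_comm (Sm.coord2 hB k l) i j x
  have c1 := c 0 1 2 3
  have c2 := c 0 2 1 3
  have c3 := c 0 3 1 2
  have c4 := c 1 2 0 3
  have c5 := c 1 3 0 2
  have c6 := c 2 3 0 1
  simp only [w22, d1]
  linear_combination h2 - h1 - h3 + h4 + c1 - c2 + c3 + c4 - c5 + c6 + a x 0 * g1
    - a x 1 * g2 + a x 2 * g3 - a x 3 * g4

lemma step12 {ω : Form1} {Ω : Form2} (hω : Sm ω) (hΩ : Sm Ω)
    (alt : ∀ᶠ x in 𝓝 (0 : Pt), ∀ i j, Ω x i j = - Ω x j i)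
    (h3 : ∀ᶠ x in 𝓝 (0 : Pt), ∀ j, Ω x 3 j = ω x j)
    (hd : ∀ᶠ x in 𝓝 (0 : Pt), d2 Ω x = w12 ω Ω x)
    (frob : ∀ᶠ x in 𝓝 (0 : Pt), w12 ω (d1 ω) x = 0)
    (hpf : pf (Ω 0) ≠ 0) (hdω : d1 ω 0 ≠ 0) :
    ∃ Φ u, Sm Φ ∧ Φ 0 = 0 ∧ Uok u ∧ NF u (pull2 Φ Ω) := by
  let η : Form1 := fun y j => y 3 * ω y j
  have hp3 : Sm (fun x : Pt => x 3) := contDiff_apply _ _ _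
  have hη : Sm η := contDiff_pi.2 fun j => hp3.mul (Sm.coord hω j)
  have hdη : ∀ x i j, d1 η x i j = ((if 3 = i then 1 else 0) * ω x j
      - (if 3 = j then 1 else 0) * ω x i) + x 3 * d1 ω x i j := by
    intro x i j
    simp only [d1, η]
    rw [pd_mul hp3 (Sm.coord hω j), pd_mul hp3 (Sm.coord hω i), pd_proj, pd_proj]
    ring
  let A : Form2 := fun x i j => Ω x i j - d1 η x i j
  have hA : Sm A := contDiff_pi.2 fun i => contDiff_pi.2 fun j =>
    (Sm.coord2 hΩ i j).sub (Sm.coord2 (d1_smooth hη) i j)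
  have hω3 : ∀ᶠ x in 𝓝 (0 : Pt), ω x 3 = 0 := by
    filter_upwards [alt, h3] with x e1 e2
    rw [← e2]; linarith [e1 3 3]
  have htri0 : tri (ω 0) (Ω 0) ≠ 0 := by
    intro h
    apply hpf
    have e1 := alt.self_of_nhds
    have e2 := h3.self_of_nhds
    rw [pf, e1 2 3, e1 1 3, e1 0 3, e2, e2, e2]
    rw [tri] at h
    linarith
  have htri : ∀ᶠ x in 𝓝 (0 : Pt), tri (ω x) (Ω x) ≠ 0 := by
    have hc : Continuous fun x => tri (ω x) (Ω x) := by
      have := fun i => (Sm.coord hω i).continuous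
      have := fun i j => (Sm.coord2 hΩ i j).continuous
      simp only [tri]
      fun_prop
    exact hc.continuousAt.eventually_ne htri0
  have hb : ∀ᶠ x in 𝓝 (0 : Pt), ∀ j, d1 ω x 3 j = 0 := by
    filter_upwards [alt, h3, frob, hω3, htri, dd_wedge hω hΩ hd] with x e1 e2 e3 e4 e5 e6
    have e7 : ∀ i j k, w12 ω (d1 ω) x i j k = 0 := fun i j k => by rw [e3]; rfl
    have f0 := e7 0 1 2
    have f1 := e7 3 0 1
    have f2 := e7 3 0 2
    have f3 := e7 3 1 2
    simp only [w12] at f0 f1 f2 f3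
    simp only [w22] at e6
    rw [e1 2 3, e1 1 3, e1 0 3, e2, e2, e2] at e6
    have a1 : ∀ i, d1 ω x i 3 = - d1 ω x 3 i := fun i => by simp only [d1]; ring
    have a2 : d1 ω x 3 3 = 0 := by simp only [d1]; ring
    rw [a1 0, a1 1, a1 2] at e6
    rw [e4] at f1 f2 f3
    have tb : d1 ω x 3 0 * Ω x 1 2 - d1 ω x 3 1 * Ω x 0 2 + d1 ω x 3 2 * Ω x 0 1 = 0 := by
      linear_combination - e6 - f0
    intro j
    have : d1 ω x 3 j * tri (ω x) (Ω x) = 0 := by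
      simp only [tri]
      fin_cases j
      · simp only [Fin.zero_eta]
        linear_combination (ω x 0) * tb - f1 * Ω x 0 2 + f2 * Ω x 0 1
      · simp only [Fin.mk_one]
        linear_combination (ω x 1) * tb - f1 * Ω x 1 2 + f3 * Ω x 0 1
      · simp only [Fin.reduceFinMk]
        linear_combination (ω x 2) * tb - f2 * Ω x 1 2 + f3 * Ω x 0 2
      · simp only [Fin.reduceFinMk]
        rw [a2]; ring
    exact (mul_eq_zero.1 this).resolve_right e5
  have hSt : St ω A := by
    refine ⟨hω, hA, ?_, hω3, ?_, hb, ?_, frob, ?_, hdω⟩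
    · filter_upwards [alt] with x e1 i j
      simp only [A, d1]
      rw [e1 i j]; ring
    · filter_upwards [h3, hb, hω3] with x e1 e2 e3 j
      simp only [A]
      rw [hdη, e1, e2, e3]; simp
    · filter_upwards [hd, frob] with x e1 e2
      ext i j k
      have g1 : d2 A x i j k = d2 Ω x i j k - d2 (d1 η) x i j k := by
        have k1 := fun i j => Sm.coord2 hΩ i j
        have k2 := fun i j => Sm.coord2 (d1_smooth hη) i j
        simp only [d2, A]
        rw [pd_sub (k1 _ _) (k2 _ _), pd_sub (k1 _ _) (k2 _ _), pd_sub (k1 _ _) (k2 _ _)]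
        ring
      rw [g1, d2_d1 hη, e1]
      have e7 : w12 ω (d1 ω) x i j k = 0 := by rw [e2]; rfl
      simp only [w12] at e7 ⊢
      simp only [A, hdη]
      linear_combination (x 3) * e7
    · have : ∀ i j : Fin 4, i ≠ 3 → j ≠ 3 → A 0 i j = Ω 0 i j := by
        intro i j hi hj
        simp only [A]
        rw [hdη]; simp [hi.symm, hj.symm]
      rw [tri, this 1 2 (by decide) (by decide), this 0 2 (by decide) (by decide),
        this 0 1 (by decide) (by decide)]
      exact htri0
  refine step8 hω (step3 hSt) ?_
  filter_upwards with x i j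
  simp only [A]
  rw [hdη]; ring

lemma pull2_ne_zero {φ : Pt → Pt} {A : Form2} {x : Pt} (hd : (Jm φ x).det ≠ 0) (hA : A (φ x) ≠ 0) :
    pull2 φ A x ≠ 0 := by
  intro h0
  have h1 := pull2_mat φ A x
  rw [h0] at h1
  apply hA
  have hu : IsUnit (Jm φ x).det := isUnit_iff_ne_zero.2 hd
  have h2 : Matrix.of (A (φ x)) = 0 := by
    have h3 : (Jm φ x).transpose⁻¹ * ((Jm φ x).transpose * Matrix.of (A (φ x)) * Jm φ x)
        * (Jm φ x)⁻¹ = 0 := by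
      rw [← h1]
      have : (Matrix.of (0 : Fin 4 → Fin 4 → ℝ)) = 0 := rfl
      rw [this]; simp
    rw [Matrix.mul_assoc (Jm φ x).transpose, Matrix.nonsing_inv_mul_cancel_left _ _
      (by rwa [Matrix.det_transpose]), Matrix.mul_nonsing_inv_cancel_right _ _ hu] at h3
    exact h3
  exact h2

lemma pull2_pf (φ : Pt → Pt) (A : Form2) (x : Pt) (h : ∀ i j, A (φ x) i j = - A (φ x) j i) :
    pf (pull2 φ A x) ^ 2 = ((Jm φ x).det * pf (A (φ x))) ^ 2 := by
  have h1 := congrArg Matrix.det (pull2_mat φ A x)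
  rw [Matrix.det_mul, Matrix.det_mul, Matrix.det_transpose, det_pf _ h,
    det_pf _ (pull2_alt φ A x h)] at h1
  simp only [pf]
  rw [h1]; ring

theorem main_global {ω : Form1} {Ω : Form2} (hω : Sm ω) (hΩ : Sm Ω) (x₀ : Pt)
    (alt : ∀ᶠ x in 𝓝 x₀, ∀ i j, Ω x i j = - Ω x j i)
    (hd : ∀ᶠ x in 𝓝 x₀, d2 Ω x = w12 ω Ω x)
    (frob : ∀ᶠ x in 𝓝 x₀, w12 ω (d1 ω) x = 0)
    (hpf : pf (Ω x₀) ≠ 0) (hω0 : ω x₀ ≠ 0) (hdω : d1 ω x₀ ≠ 0) :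
    ∃ Φ u, Sm Φ ∧ Φ 0 = x₀ ∧ Uok u ∧ NF u (pull2 Φ Ω) := by
  have ka := fun i => Sm.coord hω i
  have kA := fun i j => Sm.coord2 hΩ i j
  have hpfs : Sm (fun x => pf (Ω x)) := by
    simp only [pf]
    exact (((kA _ _).mul (kA _ _)).sub ((kA _ _).mul (kA _ _))).add ((kA _ _).mul (kA _ _))
  obtain ⟨q, hq, hqe⟩ := ext_div (f := fun _ => (1:ℝ)) contDiff_const hpfs hpf
  let v : Pt → Pt := fun x => ![
    q x * (ω x 1 * Ω x 2 3 - ω x 2 * Ω x 1 3 + ω x 3 * Ω x 1 2),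
    - (q x * (ω x 0 * Ω x 2 3 - ω x 2 * Ω x 0 3 + ω x 3 * Ω x 0 2)),
    q x * (ω x 0 * Ω x 1 3 - ω x 1 * Ω x 0 3 + ω x 3 * Ω x 0 1),
    - (q x * (ω x 0 * Ω x 1 2 - ω x 1 * Ω x 0 2 + ω x 2 * Ω x 0 1))]
  have hv : Sm v := by
    have k3 : ∀ i j k l m n p r s : Fin 4, Sm (fun x => q x * (ω x i * Ω x j k - ω x l * Ω x m n + ω x p * Ω x r s)) :=
      fun i j k l m n p r s => hq.mul ((((ka _).mul (kA _ _)).sub ((ka _).mul (kA _ _))).add ((ka _).mul (kA _ _)))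
    refine contDiff_pi.2 fun l => ?_
    fin_cases l
    · exact k3 _ _ _ _ _ _ _ _ _
    · exact (k3 _ _ _ _ _ _ _ _ _).neg
    · exact k3 _ _ _ _ _ _ _ _ _
    · exact (k3 _ _ _ _ _ _ _ _ _).neg
  have hvΩ : ∀ᶠ x in 𝓝 x₀, ∀ j, ∑ i, v x i * Ω x i j = ω x j := by
    filter_upwards [alt, hqe] with x e1 e2 j
    have z : ∀ i, Ω x i i = 0 := fun i => by linarith [e1 i i]
    have r10 := e1 1 0
    have r20 := e1 2 0
    have r21 := e1 2 1
    have r30 := e1 3 0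
    have r31 := e1 3 1
    have r32 := e1 3 2
    simp only [pf] at e2
    rw [Fin.sum_univ_four]
    fin_cases j
    · simp [v, z, r10, r20, r30]
      linear_combination ω x 0 * e2
    · simp [v, z, r21, r31]
      linear_combination ω x 1 * e2
    · simp [v, z, r32]
      linear_combination ω x 2 * e2
    · simp [v, z]
      linear_combination ω x 3 * e2
  obtain ⟨k, hk⟩ : ∃ k, v x₀ k ≠ 0 := by
    by_contra hcon
    push Not at hcon
    apply hω0
    ext j
    rw [← hvΩ.self_of_nhds j]
    simp [hcon]
  obtain ⟨φ, hφ, hφ0, hdet, hev⟩ := flowbox v hv x₀ 3 k hk ∅ (by simp) (by simp) (by simp)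
    (by intro x y h; congr 1; ext j; exact h j (by simp))
  have ht : Tendsto φ (𝓝 0) (𝓝 x₀) := by
    have := hφ.continuous.tendsto 0
    rwa [hφ0] at this
  obtain ⟨Φ, u, h1, h2, h3, h4⟩ := step12 (ω := pull1 φ ω) (Ω := pull2 φ Ω) (pull1_smooth hφ hω)
    (pull2_smooth hφ hΩ)
    (by filter_upwards [ht.eventually alt] with x hx using pull2_alt φ Ω x hx)
    (by
      filter_upwards [ht.eventually hvΩ, hev] with x e1 e2 j
      rw [pull2_eq, pull1_eq, Finset.sum_comm]
      refine Finset.sum_congr rfl fun b _ => ?_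
      rw [← e1 b, Finset.sum_mul]
      refine Finset.sum_congr rfl fun c _ => ?_
      rw [e2.1 c]; ring)
    (by
      filter_upwards [ht.eventually hd, ht.eventually alt] with x h1 h2
      rw [pull3_d2 hφ hΩ x h2, pull3_w12]
      ext i j k
      simp only [pull3, h1])
    (by
      rw [pull2_d1 hφ hω]
      filter_upwards [ht.eventually frob] with x h1
      rw [pull3_w12]
      ext i j k
      simp [pull3, h1])
    (by
      have h5 := pull2_pf φ Ω 0 (by rw [hφ0]; exact alt.self_of_nhds)
      intro h6
      rw [h6, hφ0] at h5
      have : (Jm φ 0).det * pf (Ω x₀) ≠ 0 := mul_ne_zero hdet hpf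
      have : ((Jm φ 0).det * pf (Ω x₀)) ^ 2 ≠ 0 := pow_ne_zero 2 this
      apply this; rw [← h5]; norm_num)
    (by
      rw [pull2_d1 hφ hω]
      exact pull2_ne_zero hdet (by rw [hφ0]; exact hdω))
  refine ⟨fun x => φ (Φ x), u, hφ.comp h1, by simp only [h2, hφ0], h3, ?_⟩
  rw [pull2_comp hφ h1]; exact h4

end Steps4

section Final
open Topology

local notation "Sm" => ContDiff ℝ (⊤ : ℕ∞)

lemma covec_apply (c v : Fin 4 → ℝ) : covec c v = ∑ i, c i * v i := by
  simp [covec, LinearMap.sum_apply]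

lemma finrank_of_class {ω : Form1} {x : Pt} (h : classAt ω x = 2) : Module.finrank ℝ
    ↥(LinearMap.ker (covec (ω x)) ⊓ ⨅ j, LinearMap.ker (covec (fun i => d1 ω x i j))) = 2 := by
  unfold classAt at h
  omega

lemma class_d1 {ω : Form1} {x : Pt} (h : classAt ω x = 2) : d1 ω x ≠ 0 := by
  intro h0
  have h1 := finrank_of_class h
  have h2 : (⨅ j, LinearMap.ker (covec (fun i => d1 ω x i j))) = (⊤ : Submodule ℝ Pt) := by
    rw [eq_top_iff]
    intro v _
    simp [Submodule.mem_iInf, LinearMap.mem_ker, covec_apply, h0]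
  rw [h2, inf_top_eq] at h1
  have h3 := LinearMap.finrank_range_add_finrank_ker (covec (ω x))
  have h4 : Module.finrank ℝ (LinearMap.range (covec (ω x))) ≤ 1 := by
    have := Submodule.finrank_le (LinearMap.range (covec (ω x)))
    simpa using this
  rw [h1] at h3
  simp at h3
  omega

lemma class_frob {ω : Form1} {x : Pt} (h : classAt ω x = 2) : w12 ω (d1 ω) x = 0 := by
  have h1 := finrank_of_class h
  set N := LinearMap.ker (covec (ω x)) ⊓ ⨅ j, LinearMap.ker (covec (fun i => d1 ω x i j)) with hN
  have hD : ∀ i j, d1 ω x i j = - d1 ω x j i := fun i j => by simp only [d1]; ring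
  have hmem : ∀ v ∈ N, (∑ i, ω x i * v i = 0) ∧ ∀ j, ∑ i, d1 ω x i j * v i = 0 := by
    intro v hv
    simpa [hN, Submodule.mem_iInf, LinearMap.mem_ker, covec_apply] using hv
  simp only [w12, funext_iff, Pi.zero_apply] at *
  generalize d1 ω x = D at *
  generalize ω x = w at *
  let Z : Pt := ![w 1 * D 2 3 - w 2 * D 1 3 + w 3 * D 1 2,
    -(w 0 * D 2 3 - w 2 * D 0 3 + w 3 * D 0 2),
    w 0 * D 1 3 - w 1 * D 0 3 + w 3 * D 0 1,
    -(w 0 * D 1 2 - w 1 * D 0 2 + w 2 * D 0 1)]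
  have d0 : ∀ i, D i i = 0 := fun i => by linarith [hD i i]
  have hpar : ∀ v ∈ N, ∀ a b, v a * Z b = v b * Z a := by
    intro v hv
    obtain ⟨m0, m1⟩ := hmem v hv
    have n0 := m1 0
    have n1 := m1 1
    have n2 := m1 2
    have n3 := m1 3
    rw [Fin.sum_univ_four] at m0 n0 n1 n2 n3
    rw [d0] at n0 n1 n2 n3
    rw [hD 1 0, hD 2 0, hD 3 0] at n0
    rw [hD 2 1, hD 3 1] at n1
    rw [hD 3 2] at n2
    have k01 : v 0 * Z 1 = v 1 * Z 0 := by
      simp [Z]; linear_combination (- D 2 3) * m0 + w 2 * n3 - w 3 * n2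
    have k02 : v 0 * Z 2 = v 2 * Z 0 := by
      simp [Z]; linear_combination (D 1 3) * m0 - w 1 * n3 + w 3 * n1
    have k03 : v 0 * Z 3 = v 3 * Z 0 := by
      simp [Z]; linear_combination (- D 1 2) * m0 + w 1 * n2 - w 2 * n1
    have k12 : v 1 * Z 2 = v 2 * Z 1 := by
      simp [Z]; linear_combination (- D 0 3) * m0 + w 0 * n3 - w 3 * n0
    have k13 : v 1 * Z 3 = v 3 * Z 1 := by
      simp [Z]; linear_combination (D 0 2) * m0 - w 0 * n2 + w 2 * n0
    have k23 : v 2 * Z 3 = v 3 * Z 2 := by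
      simp [Z]; linear_combination (- D 0 1) * m0 + w 0 * n1 - w 1 * n0
    intro a b
    fin_cases a <;> fin_cases b <;> first | rfl | assumption | (symm; assumption)
  have hZ : Z = 0 := by
    by_contra hne
    obtain ⟨b, hb⟩ : ∃ b, Z b ≠ 0 := by
      by_contra hcon
      push Not at hcon
      exact hne (funext hcon)
    have hle : N ≤ Submodule.span ℝ {Z} := by
      intro v hv
      rw [Submodule.mem_span_singleton]
      refine ⟨v b / Z b, ?_⟩
      ext a
      have := hpar v hv a b
      simp only [Pi.smul_apply, smul_eq_mul]
      field_simp
      linarith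
    have h2 := Submodule.finrank_mono hle
    have h3 := finrank_span_singleton (K := ℝ) hne
    omega
  have z0 : w 1 * D 2 3 - w 2 * D 1 3 + w 3 * D 1 2 = 0 := congrFun hZ 0
  have z1 : -(w 0 * D 2 3 - w 2 * D 0 3 + w 3 * D 0 2) = 0 := congrFun hZ 1
  have z2 : w 0 * D 1 3 - w 1 * D 0 3 + w 3 * D 0 1 = 0 := congrFun hZ 2
  have z3 : -(w 0 * D 1 2 - w 1 * D 0 2 + w 2 * D 0 1) = 0 := congrFun hZ 3
  have r10 := hD 1 0
  have r20 := hD 2 0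
  have r21 := hD 2 1
  have r30 := hD 3 0
  have r31 := hD 3 1
  have r32 := hD 3 2
  intro i j k
  fin_cases i <;> fin_cases j <;> fin_cases k <;>
    simp only [Fin.zero_eta, Fin.mk_one, Fin.reduceFinMk, d0, r10, r20, r21, r30, r31, r32] <;>
    linarith

lemma pf_of_w22 (B : Form2) (x : Pt) (h : ∀ i j, B x i j = - B x j i) (hr : w22 B B x ≠ 0) :
    pf (B x) ≠ 0 := by
  intro h0
  apply hr
  simp only [pf] at h0
  ext i j k l
  simp only [w22, Pi.zero_apply]
  generalize B x = D at *
  have d0 : ∀ i, D i i = 0 := fun i => by linarith [h i i]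
  have r10 := h 1 0
  have r20 := h 2 0
  have r21 := h 2 1
  have r30 := h 3 0
  have r31 := h 3 1
  have r32 := h 3 2
  fin_cases i <;> fin_cases j <;> fin_cases k <;> fin_cases l <;>
    simp only [Fin.zero_eta, Fin.mk_one, Fin.reduceFinMk, d0, r10, r20, r21, r30, r31, r32] <;>
    first
    | linear_combination 0 * h0
    | linear_combination 2 * h0
    | linear_combination (-2) * h0

lemma fderiv_det (Φ : Pt → Pt) (hΦ : Sm Φ) (x : Pt) : (fderiv ℝ Φ x).det = (Jm Φ x).det := by
  have : LinearMap.toMatrix' (fderiv ℝ Φ x : Pt →ₗ[ℝ] Pt) = Jm Φ x := by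
    ext a i
    rw [LinearMap.toMatrix'_apply, Jm, pd]
    have h1 := hasFDerivAt_pi'.1 (hΦ.differentiable (by simp) x).hasFDerivAt a
    rw [h1.fderiv]
    simp [Pi.single_apply, Pi.single]
  rw [ContinuousLinearMap.det, ← this, LinearMap.det_toMatrix']

end Final

/-- Lemma `type2a`. A germ of a rank-4 2-form of type 2 at `x₀` has,
in suitable local coordinates centred at `x₀`, the form
`Ω = exp((1+u)x³) dx¹∧dx² + dx³∧dx⁴` where `u = u(x¹,x²,x³)` vanishes at the origin and
`(u_{x¹})²(0) + (u_{x²})²(0) > 0`. -/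
theorem type2_prenormal_form (W : Set Pt) (hW : IsOpen W) (x₀ : Pt) (hx₀ : x₀ ∈ W)
    (Ω : Form2) (hΩs : ContDiffOn ℝ (⊤ : ℕ∞) Ω W)
    (hΩa : ∀ x ∈ W, ∀ i j, Ω x i j = - Ω x j i)
    (hΩr : ∀ x ∈ W, w22 Ω Ω x ≠ 0)
    (ω : Form1) (hωs : ContDiffOn ℝ (⊤ : ℕ∞) ω W)
    (hω : ∀ x ∈ W, w12 ω Ω x = d2 Ω x)
    (htype : IsTypeAt ω 2 x₀) :
    ∃ (U V : Set Pt) (φ ψ : Pt → Pt) (u : Pt → ℝ),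
      IsOpen U ∧ IsOpen V ∧ (0 : Pt) ∈ U ∧ x₀ ∈ V ∧ V ⊆ W ∧ φ 0 = x₀ ∧
      Set.MapsTo φ U V ∧ Set.MapsTo ψ V U ∧
      (∀ p ∈ U, ψ (φ p) = p) ∧ (∀ y ∈ V, φ (ψ y) = y) ∧
      ContDiffOn ℝ (⊤ : ℕ∞) φ U ∧ ContDiffOn ℝ (⊤ : ℕ∞) ψ V ∧
      -- `u` is a smooth function of the coordinates `x¹, x², x³` only, vanishing at `0`
      ContDiff ℝ (⊤ : ℕ∞) u ∧
      (∀ p q : Pt, p 0 = q 0 → p 1 = q 1 → p 2 = q 2 → u p = u q) ∧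
      u 0 = 0 ∧
      (pd 0 u 0) ^ 2 + (pd 1 u 0) ^ 2 > 0 ∧
      ∀ p ∈ U, ∀ i j, pull2 φ Ω p i j =
        Real.exp ((1 + u p) * p 2) * dxw 0 1 i j + dxw 2 3 i j := by
  obtain ⟨Ω', hΩ', eΩ⟩ := smooth_extend Ω W hW hΩs x₀ hx₀
  obtain ⟨ω', hω', eω⟩ := smooth_extend ω W hW hωs x₀ hx₀
  have hWe : ∀ᶠ x in nhds x₀, x ∈ W := hW.mem_nhds hx₀
  have hd1 : ∀ᶠ x in nhds x₀, d1 ω' x = d1 ω x := by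
    have k := eventually_all.2 fun i : Fin 4 => eventually_all.2 fun j : Fin 4 =>
      pd_congr_ev (f := fun y => ω' y j) (g := fun y => ω y j) (eω.mono fun x hx => by rw [hx]) i
    filter_upwards [k] with x hx
    ext i j
    simp only [d1, hx]
  have hd2 : ∀ᶠ x in nhds x₀, d2 Ω' x = d2 Ω x := by
    have k := eventually_all.2 fun i : Fin 4 => eventually_all.2 fun j : Fin 4 =>
      eventually_all.2 fun l : Fin 4 =>
      pd_congr_ev (f := fun y => Ω' y j l) (g := fun y => Ω y j l) (eΩ.mono fun x hx => by rw [hx]) i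
    filter_upwards [k] with x hx
    ext i j
    simp only [d2, hx]
  obtain ⟨hω0, hclass⟩ := htype
  have eΩ0 := eΩ.self_of_nhds
  have eω0 := eω.self_of_nhds
  obtain ⟨Φ, u, hΦ, hΦ0, hu, hNF⟩ := main_global hω' hΩ' x₀
    (by filter_upwards [eΩ, hWe] with x e1 e2 i j; rw [e1]; exact hΩa x e2 i j)
    (by
      filter_upwards [hd2, eΩ, eω, hWe] with x e1 e2 e3 e4
      rw [e1, ← hω x e4]
      ext i j k
      simp only [w12, e2, e3])
    (by
      filter_upwards [hd1, eω, hclass] with x e1 e2 e3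
      rw [← class_frob e3]
      ext i j k
      simp only [w12, e1, e2])
    (by rw [eΩ0]; exact pf_of_w22 Ω x₀ (hΩa x₀ hx₀) (hΩr x₀ hx₀))
    (by rw [eω0]; exact hω0)
    (by rw [hd1.self_of_nhds]; exact class_d1 hclass.self_of_nhds)
  have hdet : (Jm Φ 0).det ≠ 0 := by
    intro h0
    have h1 := pull2_pf Φ Ω' 0 (by rw [hΦ0, eΩ0]; exact hΩa x₀ hx₀)
    have h2 := hNF.self_of_nhds
    rw [h0] at h1
    simp [pf, h2, dxw] at h1
  let L : Pt ≃L[ℝ] Pt := (fderiv ℝ Φ 0).toContinuousLinearEquivOfDetNeZero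
    (by rw [fderiv_det Φ hΦ]; exact hdet)
  obtain ⟨e, he0, he, hes⟩ := smooth_inverse Φ hΦ 0 L
    (hΦ.differentiable (by simp) 0).hasFDerivAt
  obtain ⟨O, hO, hOo, h0O⟩ := eventually_nhds_iff.1 hNF
  obtain ⟨V0, hV0, hV0o, hxV0⟩ := eventually_nhds_iff.1 (eΩ.and hWe)
  have hUo : IsOpen (e.source ∩ (O ∩ Φ ⁻¹' V0)) :=
    e.open_source.inter (hOo.inter (hV0o.preimage hΦ.continuous))
  set U := e.source ∩ (O ∩ Φ ⁻¹' V0) with hU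
  have h0U : (0 : Pt) ∈ U := ⟨he0, h0O, by rw [Set.mem_preimage, hΦ0]; exact hxV0⟩
  have hVV : ∀ y ∈ e.target ∩ e.symm ⁻¹' U, Φ (e.symm y) = y := fun y hy => by
    rw [← he]; exact e.right_inv hy.1
  have hUV : Set.MapsTo Φ U (e.target ∩ e.symm ⁻¹' U) := by
    intro p hp
    rw [← he]
    refine ⟨e.map_source hp.1, ?_⟩
    rw [Set.mem_preimage, e.left_inv hp.1]
    exact hp
  refine ⟨U, e.target ∩ e.symm ⁻¹' U, Φ, e.symm, u, hUo, e.symm.isOpen_inter_preimage hUo, h0U,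
    ?_, ?_, hΦ0, hUV, fun y hy => hy.2, ?_, hVV, hΦ.contDiffOn,
    hes.mono Set.inter_subset_left, hu.sm, hu.dep, hu.zero, hu.grad, ?_⟩
  · rw [← hΦ0]; exact hUV h0U
  · intro y hy
    have h1 : Φ (e.symm y) ∈ V0 := hy.2.2.2
    rw [hVV y hy] at h1
    exact (hV0 y h1).2
  · intro p hp
    rw [← he]; exact e.left_inv hp.1
  · intro p hp i j
    rw [← hO p hp.2.1 i j, pull2_eq, pull2_eq, (hV0 _ hp.2.2).1]
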